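/- arXiv:1408.2898 — 2 statements merged into one kernel-verified Lean document; each statement's English description precedes it below -/
import Mathlib

section
/- A ≤_LR B if and only if every Π^A_1 class in Cantor space of positive μ-measure has a Π^B_1 subclass of positive μ-measure. -/
open MeasureTheory Filter

namespace LMD

/-- Codes for partial functions recursive in an oracle. -/
inductive OracleCode : Type
  | zero : OracleCode
  | succ : OracleCode
  | left : OracleCode
  | right : OracleCode
  | oracle : OracleCode
  | pair : OracleCode → OracleCode → OracleCode
  | comp : OracleCode → OracleCode → OracleCode
  | prec : OracleCode → OracleCode → OracleCode
  | rfind' : OracleCode → OracleCode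

namespace OracleCode

/-- Evaluation of an oracle code relative to a (total) oracle `O : ℕ → ℕ`. -/
def eval (O : ℕ → ℕ) : OracleCode → ℕ →. ℕ
  | zero => pure 0
  | succ => Nat.succ
  | left => ↑fun n : ℕ => n.unpair.1
  | right => ↑fun n : ℕ => n.unpair.2
  | oracle => ↑fun n : ℕ => O n
  | pair cf cg => fun n => Nat.pair <$> eval O cf n <*> eval O cg n
  | comp cf cg => fun n => eval O cg n >>= eval O cf
  | prec cf cg =>
    Nat.unpaired fun a n =>
      n.rec (eval O cf a) fun y IH => do
        let i ← IH
        eval O cg (Nat.pair a (Nat.pair y i))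
  | rfind' cf =>
    Nat.unpaired fun a m =>
      (Nat.rfind fun n => (fun m => m = 0) <$> eval O cf (Nat.pair a (n + m))).map (· + m)

/-- A Gödel numbering of oracle codes. -/
def encodeCode : OracleCode → ℕ
  | zero => 0
  | succ => 1
  | left => 2
  | right => 3
  | oracle => 4
  | pair cf cg => 4 * Nat.pair (encodeCode cf) (encodeCode cg) + 5
  | comp cf cg => 4 * Nat.pair (encodeCode cf) (encodeCode cg) + 6
  | prec cf cg => 4 * Nat.pair (encodeCode cf) (encodeCode cg) + 7
  | rfind' cf => 4 * encodeCode cf + 8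

end OracleCode

/-- `f` is partial recursive in the oracle `O`. -/
def RecursiveIn (O : ℕ → ℕ) (f : ℕ →. ℕ) : Prop := ∃ c : OracleCode, c.eval O = f

/-- The characteristic function of a set of naturals. -/
noncomputable def chi (A : Set ℕ) : ℕ → ℕ := A.indicator fun _ => 1

/-- Turing reducibility between sets of naturals. -/
def TuringLE (A B : Set ℕ) : Prop := RecursiveIn (chi B) (chi A)

/-- The Turing jump of a set of naturals. -/
def jump (B : Set ℕ) : Set ℕ :=
  {e | ∃ c : OracleCode, c.encodeCode = e ∧ (c.eval (chi B) e).Dom}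

/-- The open subset of Cantor space generated by a set of finite binary strings. -/
def Cyl (W : Set (List Bool)) : Set (ℕ → Bool) :=
  {X | ∃ σ ∈ W, ∀ i : Fin σ.length, X i = σ.get i}

/-- The fair-coin product measure on Cantor space, realized as the pushforward of
Lebesgue measure on `[0,1)` under the binary expansion map. -/
noncomputable def mu : Measure (ℕ → Bool) :=
  Measure.map (fun x n => decide (⌊x * 2 ^ (n + 1)⌋₊ % 2 = 1))
    (volume.restrict (Set.Ico (0 : ℝ) 1))

/-- `W` is a c.e.-in-`A` set of binary strings. -/
def CeIn (A : Set ℕ) (W : Set (List Bool)) : Prop :=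
  ∃ c : OracleCode, ∀ σ : List Bool, σ ∈ W ↔ (c.eval (chi A) (Encodable.encode σ)).Dom

/-- `W` is a uniformly c.e.-in-`A` sequence of sets of binary strings. -/
def CeSeqIn (A : Set ℕ) (W : ℕ → Set (List Bool)) : Prop :=
  ∃ c : OracleCode, ∀ (n : ℕ) (σ : List Bool),
    σ ∈ W n ↔ (c.eval (chi A) (Nat.pair n (Encodable.encode σ))).Dom

/-- A Martin-Löf test relative to `A`. -/
def MLTest (A : Set ℕ) (U : ℕ → Set (ℕ → Bool)) : Prop :=
  ∃ W : ℕ → Set (List Bool), CeSeqIn A W ∧ (∀ n, U n = Cyl (W n)) ∧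
    (∀ n, U (n + 1) ⊆ U n) ∧ ∀ n, mu (U n) ≤ 2⁻¹ ^ n

/-- `X` is Martin-Löf random relative to `A`. -/
def MLRandom (A : Set ℕ) (X : ℕ → Bool) : Prop :=
  ∀ U : ℕ → Set (ℕ → Bool), MLTest A U → X ∉ ⋂ n, U n

/-- `A ≤_LR B`: every `B`-random is `A`-random. -/
def LRle (A B : Set ℕ) : Prop := ∀ X : ℕ → Bool, MLRandom B X → MLRandom A X

/-- Evaluation of an oracle machine on binary strings. -/
def evalStr (c : OracleCode) (O : ℕ → ℕ) (σ : List Bool) : Part (List Bool) :=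
  (c.eval O (Encodable.encode σ)).bind fun m => Part.ofOption (Encodable.decode m)

/-- `c` is a prefix-free oracle machine: for every oracle its domain is prefix-free. -/
def PrefixFreeMachine (c : OracleCode) : Prop :=
  ∀ (O : ℕ → ℕ) (σ₁ σ₂ : List Bool), σ₁ <+: σ₂ →
    (evalStr c O σ₁).Dom → (evalStr c O σ₂).Dom → σ₁ = σ₂

/-- `u` is a universal prefix-free oracle machine. -/
def UniversalPFM (u : OracleCode) : Prop :=
  PrefixFreeMachine u ∧
    ∀ c : OracleCode, PrefixFreeMachine c → ∃ d : ℕ, ∀ (O : ℕ → ℕ) (σ τ : List Bool),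
      τ ∈ evalStr c O σ → ∃ σ' : List Bool, τ ∈ evalStr u O σ' ∧ σ'.length ≤ σ.length + d

/-- Prefix-free Kolmogorov complexity relative to the oracle `O`,
measured by the universal machine `u` (`⊤` if `τ` is not in the range). -/
noncomputable def K (u : OracleCode) (O : ℕ → ℕ) (τ : List Bool) : ℕ∞ :=
  ⨅ σ ∈ {σ : List Bool | τ ∈ evalStr u O σ}, (σ.length : ℕ∞)

/-- `A ≤_LK B` with respect to the universal machine `u`. -/
def LKle (u : OracleCode) (A B : Set ℕ) : Prop :=
  ∃ d : ℕ, ∀ τ : List Bool, K u (chi B) τ ≤ K u (chi A) τ + (d : ℕ∞)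


/-- A `Σ^A_1` class in Cantor space. -/
def Sigma1In (A : Set ℕ) (S : Set (ℕ → Bool)) : Prop :=
  ∃ W : Set (List Bool), CeIn A W ∧ S = Cyl W

/-- A `Π^A_1` class in Cantor space. -/
def Pi1In (A : Set ℕ) (S : Set (ℕ → Bool)) : Prop :=
  ∃ W : Set (List Bool), CeIn A W ∧ S = (Cyl W)ᶜ

/-- A `Σ^A_2` class: a union of a uniformly `Π^A_1` sequence of classes. -/
def Sigma2In (A : Set ℕ) (S : Set (ℕ → Bool)) : Prop :=
  ∃ W : ℕ → Set (List Bool), CeSeqIn A W ∧ S = ⋃ n, (Cyl (W n))ᶜ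

/-- A `Π^A_2` class: an intersection of a uniformly `Σ^A_1` sequence of classes. -/
def Pi2In (A : Set ℕ) (S : Set (ℕ → Bool)) : Prop :=
  ∃ W : ℕ → Set (List Bool), CeSeqIn A W ∧ S = ⋂ n, Cyl (W n)

/-- The list of the first `k` values of a sequence. -/
def tab {β : Type*} (O : ℕ → β) (k : ℕ) : List β := (List.range k).map O

@[simp] lemma length_tab {β : Type*} (O : ℕ → β) (k : ℕ) : (tab O k).length = k := by simp [tab]

lemma take_tab {β : Type*} (O : ℕ → β) {i k : ℕ} (h : i ≤ k) : (tab O k).take i = tab O i := by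
  simp [tab, ← List.map_take, List.take_range, h]

lemma OracleCode.encodeCode_injective : Function.Injective OracleCode.encodeCode := by
  intro c
  induction c with
  | zero | succ | left | right | oracle =>
    intro d h
    cases d <;> simp [encodeCode] at h ⊢
  | pair a b iha ihb | comp a b iha ihb | prec a b iha ihb =>
    intro d h
    cases d <;> simp only [encodeCode] at h <;> try omega
    rename_i a' b'
    have h' : Nat.pair a.encodeCode b.encodeCode = Nat.pair a'.encodeCode b'.encodeCode := by
      omega
    obtain ⟨h1, h2⟩ := Nat.pair_eq_pair.1 h'
    rw [iha h1, ihb h2]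
  | rfind' a iha =>
    intro d h
    cases d <;> simp only [encodeCode] at h <;> try omega
    rename_i a'
    rw [iha (show a.encodeCode = a'.encodeCode by omega)]

instance : Countable OracleCode := OracleCode.encodeCode_injective.countable

instance : Nonempty OracleCode := ⟨.zero⟩

/-- Bounded search for the least zero of a partially evaluated function. -/
def searchZero (h : ℕ → Option ℕ) (k : ℕ) : Option ℕ :=
  let i := (List.range k).findIdx fun j => !((h j).getD 0 != 0)
  if i < k ∧ h i = some 0 then some i else none

lemma searchZero_eq_some {h : ℕ → Option ℕ} {k i : ℕ} :
    searchZero h k = some i ↔ i < k ∧ h i = some 0 ∧ ∀ j < i, ∃ z, h j = some (z + 1) := by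
  have key : ∀ j, ((h j).getD 0 ≠ 0) ↔ ∃ z, h j = some (z + 1) := by
    intro j
    rcases h j with _ | _ | z <;> simp
  constructor
  · intro hs
    simp only [searchZero, Option.ite_none_right_eq_some, Option.some.injEq] at hs
    obtain ⟨⟨h1, h2⟩, h3⟩ := hs
    rw [h3] at h1 h2
    refine ⟨h1, h2, fun j hj => ?_⟩
    rw [← h3] at hj
    have := List.not_of_lt_findIdx hj
    rw [← key]
    simpa using this
  · rintro ⟨h1, h2, h3⟩
    have : (List.range k).findIdx (fun j => !((h j).getD 0 != 0)) = i := by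
      rw [List.findIdx_eq (by simpa using h1)]
      refine ⟨by simp [h2], fun j hj => ?_⟩
      simpa using (key j).2 (h3 j hj)
    simp only [searchZero, this]
    simp [h1, h2]

/-- Every oracle computation is approximated by a primitive recursive function of finite tables
of the oracle. -/
theorem OracleCode.exists_stage (O : ℕ → ℕ) (c : OracleCode) :
    ∃ g : List ℕ × ℕ → Option ℕ, Primrec g ∧
      (∀ n y j k, j ≤ k → g (tab O j, n) = some y → g (tab O k, n) = some y) ∧
      ∀ n y, y ∈ c.eval O n ↔ ∃ k, g (tab O k, n) = some y := by
  induction c with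
  | zero =>
    refine ⟨fun _ => some 0, Primrec.const _, fun _ _ _ _ _ h => h, fun n y => ?_⟩
    simp [eval, pure, PFun.pure, eq_comm]
  | succ =>
    refine ⟨fun p => some (p.2 + 1), Primrec.option_some.comp (Primrec.succ.comp Primrec.snd),
      fun _ _ _ _ _ h => h, fun n y => ?_⟩
    simp [eval, eq_comm]
  | left =>
    refine ⟨fun p => some p.2.unpair.1, Primrec.option_some.comp
      (Primrec.fst.comp (Primrec.unpair.comp Primrec.snd)), fun _ _ _ _ _ h => h, fun n y => ?_⟩
    simp [eval, eq_comm]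
  | right =>
    refine ⟨fun p => some p.2.unpair.2, Primrec.option_some.comp
      (Primrec.snd.comp (Primrec.unpair.comp Primrec.snd)), fun _ _ _ _ _ h => h, fun n y => ?_⟩
    simp [eval, eq_comm]
  | oracle =>
    have aux : ∀ n y k, (tab O k)[n]? = some y ↔ n < k ∧ O n = y := by
      intro n y k
      simp only [tab, List.getElem?_map, Option.map_eq_some_iff, List.getElem?_eq_some_iff,
        List.getElem_range, List.length_range]
      exact ⟨fun ⟨a, ⟨h, ha⟩, hy⟩ => ⟨h, ha ▸ hy⟩, fun ⟨h, hy⟩ => ⟨n, ⟨h, rfl⟩, hy⟩⟩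
    refine ⟨fun p => p.1[p.2]?, Primrec.list_getElem?, fun n y j k hjk => ?_, fun n y => ?_⟩
    · simp only [aux]
      exact fun h => ⟨by omega, h.2⟩
    · simp only [aux]
      simp only [eval, PFun.coe_val, Part.mem_some_iff]
      exact ⟨fun h => ⟨n + 1, by omega, h.symm⟩, fun ⟨_, _, h⟩ => h.symm⟩
  | pair cf cg ihf ihg =>
    obtain ⟨gf, pf, mf, sf⟩ := ihf
    obtain ⟨gg, pg, mg, sg⟩ := ihg
    refine ⟨fun p => (gf p).bind fun a => (gg p).map fun b => Nat.pair a b, ?_, ?_, ?_⟩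
    · refine Primrec.option_bind pf (Primrec.option_map (pg.comp Primrec.fst) ?_)
      exact Primrec₂.natPair.comp (Primrec.snd.comp Primrec.fst) Primrec.snd
    · intro n y j k hjk h
      simp only [Option.bind_eq_some_iff, Option.map_eq_some_iff] at h ⊢
      obtain ⟨a, ha, b, hb, rfl⟩ := h
      exact ⟨a, mf _ _ _ _ hjk ha, b, mg _ _ _ _ hjk hb, rfl⟩
    · intro n y
      simp only [eval, Seq.seq, Part.map_eq_map, Part.mem_bind_iff, Part.mem_map_iff, sf, sg,
        Option.bind_eq_some_iff, Option.map_eq_some_iff]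
      constructor
      · rintro ⟨f, ⟨a, ⟨k, hk⟩, rfl⟩, b, ⟨l, hl⟩, rfl⟩
        exact ⟨max k l, a, mf _ _ _ _ (le_max_left _ _) hk, b,
          mg _ _ _ _ (le_max_right _ _) hl, rfl⟩
      · rintro ⟨k, a, ha, b, hb, rfl⟩
        exact ⟨_, ⟨a, ⟨k, ha⟩, rfl⟩, b, ⟨k, hb⟩, rfl⟩
  | comp cf cg ihf ihg =>
    obtain ⟨gf, pf, mf, sf⟩ := ihf
    obtain ⟨gg, pg, mg, sg⟩ := ihg
    refine ⟨fun p => (gg p).bind fun a => gf (p.1, a), ?_, ?_, ?_⟩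
    · exact Primrec.option_bind pg
        (pf.comp (Primrec.pair (Primrec.fst.comp Primrec.fst) Primrec.snd))
    · intro n y j k hjk h
      simp only [Option.bind_eq_some_iff] at h ⊢
      obtain ⟨a, ha, hb⟩ := h
      exact ⟨a, mg _ _ _ _ hjk ha, mf _ _ _ _ hjk hb⟩
    · intro n y
      change y ∈ (cg.eval O n).bind (fun a => cf.eval O a) ↔ _
      simp only [Part.mem_bind_iff, sf, sg, Option.bind_eq_some_iff]
      constructor
      · rintro ⟨a, ⟨k, hk⟩, l, hl⟩
        exact ⟨max k l, a, mg _ _ _ _ (le_max_left _ _) hk, mf _ _ _ _ (le_max_right _ _) hl⟩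
      · rintro ⟨k, a, ha, hb⟩
        exact ⟨a, ⟨k, ha⟩, k, hb⟩
  | prec cf cg ihf ihg =>
    obtain ⟨gf, pf, mf, sf⟩ := ihf
    obtain ⟨gg, pg, mg, sg⟩ := ihg
    let G : List ℕ → ℕ → ℕ → Option ℕ := fun t a n =>
      n.rec (motive := fun _ => Option ℕ) (gf (t, a)) fun y IH =>
        IH.bind fun i => gg (t, Nat.pair a (Nat.pair y i))
    have mono : ∀ a n y j k, j ≤ k → G (tab O j) a n = some y → G (tab O k) a n = some y := by
      intro a n
      induction n with
      | zero => exact fun y j k hjk h => mf _ _ _ _ hjk h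
      | succ n ih =>
        intro y j k hjk h
        obtain ⟨i, hi, h⟩ := Option.bind_eq_some_iff.1 h
        exact Option.bind_eq_some_iff.2 ⟨i, ih _ _ _ hjk hi, mg _ _ _ _ hjk h⟩
    refine ⟨fun p => G p.1 p.2.unpair.1 p.2.unpair.2, ?_, fun n y j k => mono _ _ y j k,
      fun n => ?_⟩
    · have hun : Primrec fun p : List ℕ × ℕ => p.2.unpair := Primrec.unpair.comp Primrec.snd
      refine Primrec.nat_rec' (h := fun (p : List ℕ × ℕ) (q : ℕ × Option ℕ) =>
          q.2.bind fun i => gg (p.1, Nat.pair p.2.unpair.1 (Nat.pair q.1 i)))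
        (Primrec.snd.comp hun)
        (pf.comp (Primrec.pair Primrec.fst (Primrec.fst.comp hun))) ?_
      refine Primrec.option_bind (Primrec.snd.comp Primrec.snd) (pg.comp (Primrec.pair
        (Primrec.fst.comp (Primrec.fst.comp Primrec.fst)) ?_))
      refine Primrec₂.natPair.comp
        (Primrec.fst.comp (hun.comp (Primrec.fst.comp Primrec.fst)))
        (Primrec₂.natPair.comp (Primrec.fst.comp (Primrec.snd.comp Primrec.fst)) Primrec.snd)
    · let E : ℕ → ℕ → Part ℕ := fun a m => m.rec (motive := fun _ => Part ℕ) (cf.eval O a)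
        fun y IH => IH.bind fun i => cg.eval O (Nat.pair a (Nat.pair y i))
      have hE : ∀ a m y, y ∈ E a m ↔ ∃ k, G (tab O k) a m = some y := by
        intro a m
        induction m with
        | zero => exact fun y => sf a y
        | succ m ih =>
          intro y
          change y ∈ (E a m).bind (fun i => cg.eval O (Nat.pair a (Nat.pair m i))) ↔ _
          simp only [Part.mem_bind_iff, ih, sg]
          constructor
          · rintro ⟨i, ⟨k, hk⟩, l, hl⟩
            exact ⟨max k l, Option.bind_eq_some_iff.2 ⟨i, mono _ _ _ _ _ (le_max_left _ _) hk,
              mg _ _ _ _ (le_max_right _ _) hl⟩⟩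
          · rintro ⟨k, hk⟩
            obtain ⟨i, hi, h⟩ := Option.bind_eq_some_iff.1 hk
            exact ⟨i, ⟨k, hi⟩, k, h⟩
      exact hE _ _
  | rfind' cf ihf =>
    obtain ⟨gf, pf, mf, sf⟩ := ihf
    have spec : ∀ n y k : ℕ, (searchZero (fun i => gf (tab O k, Nat.pair n.unpair.1
        (i + n.unpair.2))) (tab O k).length).map (· + n.unpair.2) = some y ↔
        ∃ i, (i < k ∧ gf (tab O k, Nat.pair n.unpair.1 (i + n.unpair.2)) = some 0 ∧
          ∀ j < i, ∃ z, gf (tab O k, Nat.pair n.unpair.1 (j + n.unpair.2)) = some (z + 1)) ∧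
          i + n.unpair.2 = y := by
      intro n y k
      simp only [Option.map_eq_some_iff, searchZero_eq_some, length_tab]
    refine ⟨fun p => (searchZero (fun i => gf (p.1, Nat.pair p.2.unpair.1 (i + p.2.unpair.2)))
      p.1.length).map (· + p.2.unpair.2), ?_, ?_, ?_⟩
    · have hun : Primrec fun p : List ℕ × ℕ => p.2.unpair := Primrec.unpair.comp Primrec.snd
      have hlen : Primrec fun p : List ℕ × ℕ => p.1.length := Primrec.list_length.comp Primrec.fst
      have hg : Primrec₂ fun (p : List ℕ × ℕ) (i : ℕ) =>
          gf (p.1, Nat.pair p.2.unpair.1 (i + p.2.unpair.2)) :=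
        pf.comp (Primrec.pair (Primrec.fst.comp Primrec.fst) (Primrec₂.natPair.comp
          (Primrec.fst.comp (hun.comp Primrec.fst))
          (Primrec.nat_add.comp Primrec.snd (Primrec.snd.comp (hun.comp Primrec.fst)))))
      refine Primrec.option_map ?_
        (Primrec.nat_add.comp Primrec.snd (Primrec.snd.comp (hun.comp Primrec.fst)))
      have hi : Primrec fun p : List ℕ × ℕ => (List.range p.1.length).findIdx fun j =>
          !((gf (p.1, Nat.pair p.2.unpair.1 (j + p.2.unpair.2))).getD 0 != 0) := by
        refine Primrec.list_findIdx (Primrec.list_range.comp hlen) ?_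
        refine Primrec.not.comp (Primrec.not.comp (Primrec.beq.comp
          (Primrec.option_getD.comp hg (Primrec.const 0)) (Primrec.const 0)))
      exact Primrec.ite (PrimrecPred.and (Primrec.nat_lt.comp hi hlen)
        (Primrec.eq.comp (hg.comp Primrec.id hi) (Primrec.const _)))
        (Primrec.option_some.comp hi) (Primrec.const _)
    · intro n y j k hjk
      simp only [spec]
      rintro ⟨i, ⟨h1, h2, h3⟩, h4⟩
      exact ⟨i, ⟨by omega, mf _ _ _ _ hjk h2,
        fun j hj => (h3 j hj).imp fun z hz => mf _ _ _ _ hjk hz⟩, h4⟩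
    · intro n y
      simp only [spec]
      simp only [eval, Nat.unpaired, Part.map_eq_map]
      constructor
      · intro hy
        obtain ⟨i, hi, rfl⟩ := (Part.mem_map_iff _).1 hy
        obtain ⟨h1, h2⟩ := Nat.mem_rfind.1 hi
        obtain ⟨v, hv', hv⟩ := (Part.mem_map_iff _).1 h1
        obtain ⟨k, hk⟩ := (sf _ _).1 hv'
        obtain rfl : v = 0 := by simpa using hv
        have h2' : ∀ j : ℕ, ∃ l, j < i → ∃ z,
            gf (tab O l, Nat.pair n.unpair.1 (j + n.unpair.2)) = some (z + 1) := by
          intro j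
          by_cases hj : j < i
          · obtain ⟨v, hv', hv⟩ := (Part.mem_map_iff _).1 (h2 hj)
            obtain ⟨l, hl⟩ := (sf _ _).1 hv'
            obtain ⟨z, rfl⟩ := Nat.exists_eq_succ_of_ne_zero (by simpa using hv : v ≠ 0)
            exact ⟨l, fun _ => ⟨z, hl⟩⟩
          · exact ⟨0, fun h => absurd h hj⟩
        choose l hl using h2'
        refine ⟨max (max k (i + 1)) ((Finset.range i).sup l), i, ⟨by omega, ?_, ?_⟩, rfl⟩
        · exact mf _ _ _ _ (by omega) hk
        · intro j hj
          obtain ⟨z, hz⟩ := hl j hj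
          refine ⟨z, mf _ _ _ _ ?_ hz⟩
          exact le_max_of_le_right (Finset.le_sup (f := l) (Finset.mem_range.2 hj))
      · rintro ⟨k, i, ⟨h1, h2, h3⟩, rfl⟩
        refine (Part.mem_map_iff _).2 ⟨i, Nat.mem_rfind.2
          ⟨(Part.mem_map_iff _).2 ⟨0, (sf _ _).2 ⟨k, h2⟩, by simp⟩, fun {j} hj => ?_⟩, rfl⟩
        obtain ⟨z, hz⟩ := h3 j hj
        exact (Part.mem_map_iff _).2 ⟨z + 1, (sf _ _).2 ⟨k, hz⟩, by simp⟩

/-- A total function computed by some code from the oracle `O`. -/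
def OComp (O f : ℕ → ℕ) : Prop := ∃ c : OracleCode, ∀ n, c.eval O n = Part.some (f n)

lemma OComp.comp {O f g : ℕ → ℕ} (hf : OComp O f) (hg : OComp O g) :
    OComp O fun n => f (g n) := by
  obtain ⟨c, hc⟩ := hf
  obtain ⟨d, hd⟩ := hg
  refine ⟨.comp c d, fun n => ?_⟩
  change (d.eval O n).bind (fun a => c.eval O a) = _
  rw [hd, Part.bind_some, hc]

lemma OComp.pair {O f g : ℕ → ℕ} (hf : OComp O f) (hg : OComp O g) :
    OComp O fun n => Nat.pair (f n) (g n) := by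
  obtain ⟨c, hc⟩ := hf
  obtain ⟨d, hd⟩ := hg
  exact ⟨.pair c d, fun n => by simp [OracleCode.eval, hc, hd, Seq.seq]⟩

lemma OComp.prec {O f g : ℕ → ℕ} (hf : OComp O f) (hg : OComp O g) :
    OComp O fun n => n.unpair.2.rec (motive := fun _ => ℕ) (f n.unpair.1)
      fun y IH => g (Nat.pair n.unpair.1 (Nat.pair y IH)) := by
  obtain ⟨c, hc⟩ := hf
  obtain ⟨d, hd⟩ := hg
  let E : ℕ → ℕ → Part ℕ := fun a m => m.rec (motive := fun _ => Part ℕ) (c.eval O a)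
    fun y IH => IH.bind fun i => d.eval O (Nat.pair a (Nat.pair y i))
  have hE : ∀ a m, E a m = Part.some (m.rec (motive := fun _ => ℕ) (f a)
      fun y IH => g (Nat.pair a (Nat.pair y IH))) := by
    intro a m
    induction m with
    | zero => exact hc a
    | succ m ih =>
      change (E a m).bind (fun i => d.eval O (Nat.pair a (Nat.pair m i))) = _
      rw [ih, Part.bind_some, hd]
  exact ⟨.prec c d, fun n => hE _ _⟩

lemma OComp.of_primrec {O f : ℕ → ℕ} (hf : Nat.Primrec f) : OComp O f := by
  induction hf with
  | zero => exact ⟨.zero, fun _ => rfl⟩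
  | succ => exact ⟨.succ, fun _ => rfl⟩
  | left => exact ⟨.left, fun _ => rfl⟩
  | right => exact ⟨.right, fun _ => rfl⟩
  | pair _ _ ihf ihg => exact ihf.pair ihg
  | comp _ _ ihf ihg => exact ihf.comp ihg
  | prec _ _ ihf ihg => exact ihf.prec ihg

lemma OComp.tab (O : ℕ → ℕ) : OComp O fun k => Encodable.encode (tab O k) := by
  let snoc : ℕ → ℕ := fun m =>
    Encodable.encode (((Encodable.decode (α := List ℕ) m.unpair.1).getD []) ++ [m.unpair.2])
  have hsnoc : Nat.Primrec snoc := Primrec.nat_iff.1 <| Primrec.encode.comp <|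
    Primrec.list_concat.comp (Primrec.option_getD.comp
      (Primrec.decode.comp (Primrec.fst.comp Primrec.unpair)) (Primrec.const []))
      (Primrec.snd.comp Primrec.unpair)
  have ho : OComp O O := ⟨.oracle, fun _ => rfl⟩
  have hl : OComp O fun m => m.unpair.1 := .of_primrec .left
  have hr : OComp O fun m => m.unpair.2 := .of_primrec .right
  have hstep : OComp O fun m => snoc (Nat.pair m.unpair.2.unpair.2 (O m.unpair.2.unpair.1)) :=
    (OComp.of_primrec hsnoc).comp (OComp.pair (hr.comp hr) (ho.comp (hl.comp hr)))
  obtain ⟨c, hc⟩ := ((OComp.of_primrec .zero).prec hstep).comp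
    (OComp.pair (OComp.of_primrec .zero) (.of_primrec .id))
  refine ⟨c, fun n => (hc n).trans (congrArg _ ?_)⟩
  simp only [Nat.unpair_pair, id]
  induction n with
  | zero => rfl
  | succ m ih =>
    simp only [ih]
    simp [snoc, LMD.tab, List.range_succ]

/-- `p` is semidecidable relative to `O`: it is the increasing union of stages that are primitive
recursive in finite tables of the oracle. -/
def Semi {α : Type*} [Primcodable α] (O : ℕ → ℕ) (p : α → Prop) : Prop :=
  ∃ R : List ℕ × α → Prop, PrimrecPred R ∧
    (∀ a j k, j ≤ k → R (tab O j, a) → R (tab O k, a)) ∧ ∀ a, p a ↔ ∃ k, R (tab O k, a)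

/-- The domain of an oracle code is semidecidable, also along a coding. -/
lemma Semi.of_eval {α : Type*} [Primcodable α] {O : ℕ → ℕ} (c : OracleCode) {f : α → ℕ}
    (hf : Primrec f) : Semi O fun a => (c.eval O (f a)).Dom := by
  obtain ⟨g, pg, mg, sg⟩ := c.exists_stage O
  refine ⟨fun q => (g (q.1, f q.2)).isSome = true, ?_, ?_, ?_⟩
  · exact Primrec.eq.comp (Primrec.option_isSome.comp
      (pg.comp (Primrec.pair Primrec.fst (hf.comp Primrec.snd)))) (Primrec.const _)
  · intro a j k hjk h
    obtain ⟨y, hy⟩ := Option.isSome_iff_exists.1 h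
    exact Option.isSome_iff_exists.2 ⟨y, mg _ _ _ _ hjk hy⟩
  · intro a
    simp only [Part.dom_iff_mem, sg, Option.isSome_iff_exists]
    exact exists_comm

/-- A semidecidable predicate is the domain of an oracle code. -/
lemma Semi.exists_code {α : Type*} [Primcodable α] {O : ℕ → ℕ} {p : α → Prop} (hp : Semi O p) :
    ∃ c : OracleCode, ∀ a, p a ↔ (c.eval O (Encodable.encode a)).Dom := by
  obtain ⟨R, ⟨_, pR⟩, mR, sR⟩ := hp
  let T : ℕ → ℕ := fun m =>
    Encodable.encode (((Encodable.decode (α := List ℕ × α) m).map fun q => !decide (R q)).getD true)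
  have hT : Nat.Primrec T := Primrec.nat_iff.1 <| Primrec.encode.comp <|
    Primrec.option_getD.comp (Primrec.option_map Primrec.decode
      (Primrec.not.comp (pR.comp Primrec.snd))) (Primrec.const true)
  have hl : OComp O fun m => m.unpair.1 := .of_primrec .left
  have hr : OComp O fun m => m.unpair.2 := .of_primrec .right
  obtain ⟨d, hd⟩ : OComp O fun m =>
      T (Nat.pair (Encodable.encode (tab O m.unpair.2)) m.unpair.1) :=
    (OComp.of_primrec hT).comp (((OComp.tab O).comp hr).pair hl)
  obtain ⟨e, he⟩ : OComp O fun m => Nat.pair m 0 :=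
    (OComp.of_primrec .id).pair (.of_primrec .zero)
  refine ⟨.comp (.rfind' d) e, fun a => ?_⟩
  have hTa : ∀ k, T (Nat.pair (Encodable.encode (tab O k)) (Encodable.encode a)) = 0 ↔
      R (tab O k, a) := by
    intro k
    have : Nat.pair (Encodable.encode (tab O k)) (Encodable.encode a) =
      Encodable.encode (tab O k, a) := rfl
    simp only [T, this, Encodable.encodek, Option.map_some, Option.getD_some]
    by_cases h : R (tab O k, a) <;> simp [h]
  rw [sR]
  simp only [← hTa]
  change _ ↔ ((e.eval O _).bind (fun b => OracleCode.eval O (.rfind' d) b)).Dom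
  rw [he, Part.bind_some]
  simp only [OracleCode.eval, Nat.unpaired, hd, Nat.unpair_pair, Part.map_eq_map, Part.map_some,
    Nat.add_zero, Part.map_Dom]
  refine Iff.trans ?_ Nat.rfind_dom.symm
  simp

lemma exists_stage_forall_mem {α : Type*} {R : ℕ → α → Prop} (mR : ∀ a j k, j ≤ k → R j a → R k a)
    (L : List α) (h : ∀ x ∈ L, ∃ k, R k x) : ∃ k, ∀ x ∈ L, R k x := by
  induction L with
  | nil => exact ⟨0, by simp⟩
  | cons a L ih =>
    obtain ⟨k, hk⟩ := ih fun x hx => h x (List.mem_cons_of_mem _ hx)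
    obtain ⟨l, hl⟩ := h a List.mem_cons_self
    refine ⟨max k l, fun x hx => ?_⟩
    rcases List.mem_cons.1 hx with rfl | hx
    · exact mR _ _ _ (le_max_right _ _) hl
    · exact mR _ _ _ (le_max_left _ _) (hk x hx)

section Closure

variable {α β : Type*} [Primcodable α] [Primcodable β] {O : ℕ → ℕ}

lemma primrecPred_exists_lt {p : ℕ × α → Prop} (hp : PrimrecPred p) {f : α → ℕ}
    (hf : Primrec f) : PrimrecPred fun a => ∃ i < f a, p (i, a) :=
  ((PrimrecRel.exists_mem_list (R := fun (i : ℕ) (a : α) => p (i, a)) hp).comp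
    (Primrec.list_range.comp hf) Primrec.id).of_eq (by simp)

lemma primrecPred_forall_lt {p : ℕ × α → Prop} (hp : PrimrecPred p) {f : α → ℕ}
    (hf : Primrec f) : PrimrecPred fun a => ∀ i < f a, p (i, a) :=
  ((PrimrecRel.forall_mem_list (R := fun (i : ℕ) (a : α) => p (i, a)) hp).comp
    (Primrec.list_range.comp hf) Primrec.id).of_eq (by simp)

lemma Semi.of_primrecPred {p : α → Prop} (hp : PrimrecPred p) : Semi O p :=
  ⟨fun q => p q.2, hp.comp Primrec.snd, fun _ _ _ _ h => h, fun _ => by simp⟩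

lemma Semi.comp {p : β → Prop} (hp : Semi O p) {f : α → β} (hf : Primrec f) :
    Semi O fun a => p (f a) := by
  obtain ⟨R, pR, mR, sR⟩ := hp
  exact ⟨fun q => R (q.1, f q.2), pR.comp (Primrec.pair Primrec.fst (hf.comp Primrec.snd)),
    fun a => mR (f a), fun a => sR (f a)⟩

lemma Semi.of_iff {p q : α → Prop} (hp : Semi O p) (h : ∀ a, q a ↔ p a) : Semi O q := by
  rwa [funext fun a => propext (h a)]

lemma Semi.and {p q : α → Prop} (hp : Semi O p) (hq : Semi O q) :
    Semi O fun a => p a ∧ q a := by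
  obtain ⟨R, pR, mR, sR⟩ := hp
  obtain ⟨S, pS, mS, sS⟩ := hq
  refine ⟨fun a => R a ∧ S a, pR.and pS,
    fun a j k hjk h => ⟨mR _ _ _ hjk h.1, mS _ _ _ hjk h.2⟩, fun a => ?_⟩
  change p a ∧ q a ↔ ∃ k, R (tab O k, a) ∧ S (tab O k, a)
  rw [sR, sS]
  constructor
  · rintro ⟨⟨k, hk⟩, l, hl⟩
    exact ⟨max k l, mR _ _ _ (le_max_left _ _) hk, mS _ _ _ (le_max_right _ _) hl⟩
  · rintro ⟨k, hk, hl⟩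
    exact ⟨⟨k, hk⟩, k, hl⟩

lemma Semi.or {p q : α → Prop} (hp : Semi O p) (hq : Semi O q) :
    Semi O fun a => p a ∨ q a := by
  obtain ⟨R, pR, mR, sR⟩ := hp
  obtain ⟨S, pS, mS, sS⟩ := hq
  refine ⟨fun a => R a ∨ S a, pR.or pS,
    fun a j k hjk h => h.imp (mR _ _ _ hjk) (mS _ _ _ hjk), fun a => ?_⟩
  change p a ∨ q a ↔ ∃ k, R (tab O k, a) ∨ S (tab O k, a)
  rw [sR, sS, exists_or]

lemma Semi.exists {p : α × β → Prop} (hp : Semi O p) : Semi O fun b => ∃ a, p (a, b) := by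
  obtain ⟨R, pR, mR, sR⟩ := hp
  refine ⟨fun q => ∃ i < q.1.length, ∃ a, Encodable.decode (α := α) i = some a ∧
    R (q.1, (a, q.2)), ?_, ?_, ?_⟩
  · refine primrecPred_exists_lt (p := fun q : ℕ × (List ℕ × β) => ∃ a,
      Encodable.decode (α := α) q.1 = some a ∧ R (q.2.1, (a, q.2.2))) ?_
      (Primrec.list_length.comp Primrec.fst)
    obtain ⟨_, pR⟩ := pR
    have : Primrec fun q : ℕ × (List ℕ × β) => ((Encodable.decode (α := α) q.1).map
        fun a => decide (R (q.2.1, (a, q.2.2)))).getD false := by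
      refine Primrec.option_getD.comp (Primrec.option_map (Primrec.decode.comp Primrec.fst) ?_)
        (Primrec.const _)
      exact pR.comp (Primrec.pair (Primrec.fst.comp (Primrec.snd.comp Primrec.fst))
        (Primrec.pair Primrec.snd (Primrec.snd.comp (Primrec.snd.comp Primrec.fst))))
    refine (Primrec.eq.comp this (Primrec.const true)).of_eq fun q => ?_
    cases Encodable.decode (α := α) q.1 <;> simp
  · rintro b j k hjk ⟨i, hi, a, ha, h⟩
    simp only [length_tab] at hi
    exact ⟨i, by simp only [length_tab]; omega, a, ha, mR _ _ _ hjk h⟩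
  · intro b
    simp only [sR, length_tab]
    constructor
    · rintro ⟨a, k, hk⟩
      exact ⟨max k (Encodable.encode a + 1), Encodable.encode a, by omega, a,
        Encodable.encodek a, mR _ _ _ (le_max_left _ _) hk⟩
    · rintro ⟨k, _, _, a, _, h⟩
      exact ⟨a, k, h⟩

lemma Semi.forall_mem {p : α → Prop} (hp : Semi O p) :
    Semi O fun L : List α => ∀ x ∈ L, p x := by
  obtain ⟨R, pR, mR, sR⟩ := hp
  refine ⟨fun q => ∀ x ∈ q.2, R (q.1, x), ?_, ?_, ?_⟩
  · exact (PrimrecRel.forall_mem_list (R := fun x t => R (t, x))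
      (pR.comp (Primrec.pair Primrec.snd Primrec.fst))).comp Primrec.snd Primrec.fst
  · exact fun L j k hjk h x hx => mR _ _ _ hjk (h x hx)
  · intro L
    constructor
    · exact fun h => exists_stage_forall_mem (R := fun k x => R (tab O k, x)) mR L
        fun x hx => (sR x).1 (h x hx)
    · exact fun ⟨k, hk⟩ x hx => (sR x).2 ⟨k, hk x hx⟩

end Closure

lemma ceIn_iff {A : Set ℕ} {W : Set (List Bool)} : CeIn A W ↔ Semi (chi A) (· ∈ W) := by
  constructor
  · rintro ⟨c, hc⟩
    exact (Semi.of_eval c Primrec.encode).of_iff hc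
  · exact fun h => h.exists_code

lemma ceSeqIn_iff {A : Set ℕ} {W : ℕ → Set (List Bool)} :
    CeSeqIn A W ↔ Semi (chi A) fun p : ℕ × List Bool => p.2 ∈ W p.1 := by
  constructor
  · rintro ⟨c, hc⟩
    exact (Semi.of_eval c (Primrec₂.natPair.comp Primrec.fst
      (Primrec.encode.comp Primrec.snd))).of_iff fun p => hc p.1 p.2
  · intro h
    obtain ⟨c, hc⟩ := h.exists_code
    exact ⟨c, fun n σ => hc (n, σ)⟩

/-- Prepend a bit to a sequence. -/
def cons (b : Bool) (X : ℕ → Bool) : ℕ → Bool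
  | 0 => b
  | n + 1 => X n

/-- Prepend a string to a sequence. -/
def cat (σ : List Bool) (X : ℕ → Bool) : ℕ → Bool := σ.foldr cons X

/-- The sequence without its first `j` bits. -/
def tail (j : ℕ) (X : ℕ → Bool) : ℕ → Bool := fun n => X (j + n)

/-- The cylinder of a single string. -/
def cyl (σ : List Bool) : Set (ℕ → Bool) := {X | tab X σ.length = σ}

lemma tab_cons (b : Bool) (X : ℕ → Bool) (n : ℕ) : tab (cons b X) (n + 1) = b :: tab X n := by
  simp only [tab, List.range_succ_eq_map, List.map_cons, List.map_map]
  rfl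

lemma tab_cat (σ : List Bool) (X : ℕ → Bool) (n : ℕ) :
    tab (cat σ X) (σ.length + n) = σ ++ tab X n := by
  induction σ with
  | nil => simp [cat]
  | cons b σ ih =>
    rw [List.length_cons, show σ.length + 1 + n = σ.length + n + 1 by omega, cat, List.foldr_cons,
      tab_cons, ← cat, ih, List.cons_append]

lemma tab_add (X : ℕ → Bool) (m n : ℕ) : tab X (m + n) = tab X m ++ tab (tail m X) n := by
  simp only [tab, List.range_add, List.map_append, List.map_map]
  rfl

lemma cons_head_tail (X : ℕ → Bool) : cons (X 0) (tail 1 X) = X := by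
  funext n
  cases n with
  | zero => rfl
  | succ n => simp [cons, tail, Nat.add_comm]

lemma tail_cat (σ : List Bool) (X : ℕ → Bool) : tail σ.length (cat σ X) = X := by
  induction σ with
  | nil => funext n; simp [cat, tail]
  | cons b σ ih =>
    funext n
    change cons b (cat σ X) (σ.length + 1 + n) = X n
    rw [Nat.add_right_comm]
    exact congrFun ih n

lemma cat_tab_tail (X : ℕ → Bool) (m : ℕ) : cat (tab X m) (tail m X) = X := by
  induction m generalizing X with
  | zero => funext n; simp [cat, tail, tab]
  | succ m ih =>
    conv_rhs => rw [← cons_head_tail X, ← ih (tail 1 X)]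
    rw [Nat.add_comm, tab_add]
    have h : tail (1 + m) X = tail m (tail 1 X) := by
      funext n
      simp [tail, Nat.add_assoc]
    rw [h]
    simp [cat, tab]

lemma tail_tail (X : ℕ → Bool) (i j : ℕ) : tail i (tail j X) = tail (j + i) X := by
  funext n
  simp [tail, Nat.add_assoc]

lemma mem_cyl_tab (X : ℕ → Bool) (n : ℕ) : X ∈ cyl (tab X n) := by simp [cyl]

lemma cyl_eq_iInter (σ : List Bool) :
    cyl σ = ⋂ i : Fin σ.length, {X | X i = σ.get i} := by
  ext X
  simp only [cyl, Set.mem_ofPred_eq, Set.mem_iInter]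
  constructor
  · intro h i
    have := List.getElem_of_eq h (i := i) (by simp)
    simpa [tab] using this
  · intro h
    refine List.ext_getElem (by simp) fun i h1 h2 => ?_
    simpa [tab] using h ⟨i, h2⟩

lemma Cyl_eq_iUnion (W : Set (List Bool)) : Cyl W = ⋃ σ ∈ W, cyl σ := by
  ext X
  simp [Cyl, cyl_eq_iInter]

lemma mem_Cyl {W : Set (List Bool)} {X : ℕ → Bool} : X ∈ Cyl W ↔ ∃ n, tab X n ∈ W := by
  simp only [Cyl_eq_iUnion, Set.mem_iUnion, exists_prop]
  constructor
  · rintro ⟨σ, hσ, hX⟩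
    exact ⟨σ.length, by rwa [show tab X σ.length = σ from hX]⟩
  · rintro ⟨n, hn⟩
    exact ⟨_, hn, mem_cyl_tab X n⟩

lemma isOpen_cyl (σ : List Bool) : IsOpen (cyl σ) := by
  rw [cyl_eq_iInter]
  exact isOpen_iInter_of_finite fun i =>
    IsOpen.preimage (f := fun X : ℕ → Bool => X i) (continuous_apply _)
      (isOpen_discrete {σ.get i})

lemma isOpen_Cyl (W : Set (List Bool)) : IsOpen (Cyl W) := by
  rw [Cyl_eq_iUnion]
  exact isOpen_biUnion fun σ _ => isOpen_cyl σ

lemma measurableSet_cyl (σ : List Bool) : MeasurableSet (cyl σ) := by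
  rw [cyl_eq_iInter]
  exact MeasurableSet.iInter fun i => measurable_pi_apply (i : ℕ) (measurableSet_singleton _)

lemma measurableSet_Cyl (W : Set (List Bool)) : MeasurableSet (Cyl W) := by
  rw [Cyl_eq_iUnion]
  exact MeasurableSet.biUnion (Set.to_countable _) fun σ _ => measurableSet_cyl σ

lemma measurable_cons (b : Bool) : Measurable (cons b) := by
  refine measurable_pi_iff.2 fun n => ?_
  cases n with
  | zero => exact measurable_const
  | succ n => exact measurable_pi_apply n

/-- Binary expansion. -/
noncomputable def expansion (x : ℝ) (n : ℕ) : Bool := decide (⌊x * 2 ^ (n + 1)⌋₊ % 2 = 1)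

lemma measurable_expansion : Measurable expansion := by
  refine measurable_pi_iff.2 fun n => ?_
  have h : Measurable fun x : ℝ => ⌊x * 2 ^ (n + 1)⌋₊ :=
    Nat.measurable_floor.comp (measurable_id.mul_const _)
  exact (measurable_from_top (f := fun m : ℕ => decide (m % 2 = 1))).comp h

lemma mu_apply {E : Set (ℕ → Bool)} (hE : MeasurableSet E) :
    mu E = volume (expansion ⁻¹' E ∩ Set.Ico 0 1) := by
  change Measure.map expansion _ E = _
  rw [Measure.map_apply measurable_expansion hE,
    Measure.restrict_apply (measurable_expansion hE)]

instance : IsProbabilityMeasure mu := ⟨by rw [mu_apply MeasurableSet.univ]; simp⟩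

lemma expansion_eq_cons (b : ℕ) (hb : b < 2) {x : ℝ} (h0 : 0 ≤ 2 * x - b) (h1 : 2 * x - b < 1) :
    expansion x = cons (decide (b = 1)) (expansion (2 * x - b)) := by
  funext n
  cases n with
  | zero =>
    have : ⌊x * 2 ^ (0 + 1)⌋₊ = b := by
      have hb0 : (0 : ℝ) ≤ b := by positivity
      have hx : 0 ≤ x * 2 ^ (0 + 1) := by
        rw [zero_add, pow_one]
        linarith
      rw [Nat.floor_eq_iff hx]
      rw [zero_add, pow_one]
      constructor <;> linarith
    simp only [expansion, this, cons]
    congr 2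
    omega
  | succ n =>
    have : x * 2 ^ (n + 1 + 1) = (2 * x - b) * 2 ^ (n + 1) + ((b * 2 ^ (n + 1) : ℕ) : ℝ) := by
      push_cast
      ring
    simp only [expansion, cons, this]
    rw [Nat.floor_add_natCast (by positivity)]
    congr 2
    have : b * 2 ^ (n + 1) = 2 * (b * 2 ^ n) := by ring
    rw [this, Nat.add_mul_mod_self_left]

lemma volume_expansion_half {E : Set (ℕ → Bool)} (hE : MeasurableSet E) (b : ℕ) (hb : b < 2) :
    volume (expansion ⁻¹' E ∩ Set.Ico ((b : ℝ) / 2) ((b + 1) / 2)) =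
      2⁻¹ * mu (cons (decide (b = 1)) ⁻¹' E) := by
  rw [mu_apply (measurable_cons _ hE)]
  have : expansion ⁻¹' E ∩ Set.Ico ((b : ℝ) / 2) ((b + 1) / 2) = (fun x => 2 * x) ⁻¹'
      ((fun x => x + (-b : ℝ)) ⁻¹'
        (expansion ⁻¹' (cons (decide (b = 1)) ⁻¹' E) ∩ Set.Ico 0 1)) := by
    ext x
    simp only [Set.mem_inter_iff, Set.mem_preimage, Set.mem_Ico, ← sub_eq_add_neg]
    constructor
    · rintro ⟨h, h0, h1⟩
      have h0' : 0 ≤ 2 * x - b := by linarith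
      have h1' : 2 * x - b < 1 := by linarith
      exact ⟨by rwa [← expansion_eq_cons b hb h0' h1'], h0', h1'⟩
    · rintro ⟨h, h0, h1⟩
      exact ⟨by rwa [← expansion_eq_cons b hb h0 h1] at h, by linarith, by linarith⟩
  rw [this, Real.volume_preimage_mul_left two_ne_zero, measure_preimage_add_right]
  congr 1
  rw [abs_of_pos (by norm_num), ENNReal.ofReal_inv_of_pos two_pos]
  simp

lemma mu_eq_half_add_half {E : Set (ℕ → Bool)} (hE : MeasurableSet E) :
    mu E = 2⁻¹ * mu (cons false ⁻¹' E) + 2⁻¹ * mu (cons true ⁻¹' E) := by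
  have h0 := volume_expansion_half hE 0 (by norm_num)
  have h1 := volume_expansion_half hE 1 (by norm_num)
  norm_num at h0 h1
  rw [← h0, ← h1, mu_apply hE, ← measure_union]
  · rw [← Set.inter_union_distrib_left, Set.Ico_union_Ico_eq_Ico (by norm_num) (by norm_num)]
  · refine Set.disjoint_left.2 fun x hx hx' => ?_
    have := hx.2.2
    have := hx'.2.1
    linarith
  · exact (measurable_expansion hE).inter measurableSet_Ico

lemma mu_inter_cyl (σ : List Bool) {E : Set (ℕ → Bool)} (hE : MeasurableSet E) :
    mu (E ∩ cyl σ) = 2⁻¹ ^ σ.length * mu (cat σ ⁻¹' E) := by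
  induction σ generalizing E with
  | nil =>
    have : cyl [] = Set.univ := by ext; simp [cyl, tab]
    simp [this, show cat [] = id from rfl]
  | cons b σ ih =>
    rw [mu_eq_half_add_half (hE.inter (measurableSet_cyl _))]
    have h1 : cons b ⁻¹' (E ∩ cyl (b :: σ)) = cons b ⁻¹' E ∩ cyl σ := by
      ext X
      simp [cyl, tab_cons]
    have h2 : cons (!b) ⁻¹' (E ∩ cyl (b :: σ)) = ∅ := by
      ext X
      simp [cyl, tab_cons]
    have h3 : cat (b :: σ) ⁻¹' E = cat σ ⁻¹' (cons b ⁻¹' E) := rfl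
    have h4 := ih (measurable_cons b hE)
    rw [List.length_cons, pow_succ', h3, mul_assoc, ← h4]
    cases b <;> simp_all

lemma mu_cyl (σ : List Bool) : mu (cyl σ) = 2⁻¹ ^ σ.length := by
  simpa using mu_inter_cyl σ MeasurableSet.univ

/-- The list of all binary strings of a given length. -/
def strings : ℕ → List (List Bool)
  | 0 => [[]]
  | n + 1 => (strings n).map (false :: ·) ++ (strings n).map (true :: ·)

lemma mem_strings {n : ℕ} {σ : List Bool} : σ ∈ strings n ↔ σ.length = n := by
  induction n generalizing σ with
  | zero => simp [strings]
  | succ n ih =>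
    rcases σ with _ | ⟨_ | _, σ⟩ <;> simp [strings, ih]

lemma primrec_strings : Primrec strings := by
  have h : Primrec₂ fun (_ : ℕ) (L : List (List Bool)) =>
      L.map (false :: ·) ++ L.map (true :: ·) := by
    refine Primrec.list_append.comp ?_ ?_ <;>
    exact Primrec.list_map Primrec.snd (Primrec.list_cons.comp (Primrec.const _) Primrec.snd)
  refine (Primrec.nat_rec₁ [[]] h).of_eq fun n => ?_
  induction n with
  | zero => rfl
  | succ n ih => simp only [strings, ← ih]

lemma measurableSet_tab (p : List Bool → Prop) (n : ℕ) : MeasurableSet {X | p (tab X n)} := by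
  have : {X : ℕ → Bool | p (tab X n)} = ⋃ σ ∈ {σ : List Bool | σ.length = n ∧ p σ}, cyl σ := by
    ext X
    simp only [Set.mem_ofPred_eq, Set.mem_iUnion, exists_prop]
    constructor
    · exact fun h => ⟨_, ⟨by simp, h⟩, mem_cyl_tab X n⟩
    · rintro ⟨σ, ⟨rfl, h⟩, hX⟩
      rwa [show tab X σ.length = σ from hX]
  rw [this]
  exact MeasurableSet.biUnion (Set.to_countable _) fun σ _ => measurableSet_cyl σ

lemma mu_tab (p : List Bool → Prop) [DecidablePred p] (n : ℕ) :
    mu {X | p (tab X n)} = ((strings n).filter p).length * 2⁻¹ ^ n := by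
  induction n generalizing p with
  | zero =>
    by_cases h : p [] <;> simp [tab, strings, h]
  | succ n ih =>
    rw [mu_eq_half_add_half (measurableSet_tab p _)]
    simp only [Set.preimage_ofPred_eq, tab_cons]
    rw [ih fun σ => p (false :: σ), ih fun σ => p (true :: σ)]
    simp only [strings, List.filter_append, List.filter_map, List.length_append, List.length_map,
      Function.comp_def, Nat.cast_add, pow_succ']
    ring

lemma exists_prefixFree {O : ℕ → ℕ} {W : Set (List Bool)} (hW : Semi O (· ∈ W)) :
    ∃ V : Set (List Bool), Semi O (· ∈ V) ∧ Cyl V = Cyl W ∧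
      ∀ X m n, tab X m ∈ V → tab X n ∈ V → m = n := by
  obtain ⟨R, pR, mR, sR⟩ := hW
  let S : List ℕ × List Bool → Prop := fun q => ∃ i < q.2.length + 1, R (q.1, q.2.take i)
  have pS : PrimrecPred S := by
    refine primrecPred_exists_lt (p := fun q : ℕ × (List ℕ × List Bool) =>
      R (q.2.1, q.2.2.take q.1)) ?_ (Primrec.succ.comp (Primrec.list_length.comp Primrec.snd))
    exact pR.comp (Primrec.pair (Primrec.fst.comp Primrec.snd)
      (Primrec.list_take.comp Primrec.fst (Primrec.snd.comp Primrec.snd)))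
  let T : List ℕ × List Bool → Prop := fun q => S (q.1.take q.2.length, q.2) ∧
    ∀ i < q.2.length, ¬ S (q.1.take i, q.2.take i)
  have pT : PrimrecPred T := by
    refine PrimrecPred.and (pS.comp (Primrec.pair (Primrec.list_take.comp
      (Primrec.list_length.comp Primrec.snd) Primrec.fst) Primrec.snd)) ?_
    refine primrecPred_forall_lt (p := fun q : ℕ × (List ℕ × List Bool) =>
      ¬ S (q.2.1.take q.1, q.2.2.take q.1)) ?_ (Primrec.list_length.comp Primrec.snd)
    exact (pS.comp (Primrec.pair
      (Primrec.list_take.comp Primrec.fst (Primrec.fst.comp Primrec.snd))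
      (Primrec.list_take.comp Primrec.fst (Primrec.snd.comp Primrec.snd)))).not
  have hT : ∀ {k : ℕ} {ρ : List Bool}, ρ.length ≤ k → (T (tab O k, ρ) ↔ T (tab O ρ.length, ρ)) := by
    intro k ρ hk
    simp only [T, take_tab O hk, take_tab O le_rfl]
    refine and_congr_right fun _ => forall₂_congr fun i hi => ?_
    rw [take_tab O (hi.le.trans hk), take_tab O hi.le]
  have hV : ∀ X n, T (tab O n, tab X n) ↔
      S (tab O n, tab X n) ∧ ∀ i < n, ¬ S (tab O i, tab X i) := by
    intro X n
    simp only [T, length_tab, take_tab O le_rfl]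
    refine and_congr_right fun _ => forall₂_congr fun i hi => ?_
    rw [take_tab O hi.le, take_tab X hi.le]
  refine ⟨{ρ | T (tab O ρ.length, ρ)}, ⟨fun q => q.2.length ≤ q.1.length ∧ T q, ?_, ?_, ?_⟩, ?_, ?_⟩
  · exact (Primrec.nat_le.comp (Primrec.list_length.comp Primrec.snd)
      (Primrec.list_length.comp Primrec.fst)).and pT
  · rintro ρ j k hjk ⟨h, h'⟩
    simp only [length_tab] at h ⊢
    exact ⟨h.trans hjk, (hT (h.trans hjk)).2 ((hT h).1 h')⟩
  · intro ρ
    simp only [length_tab]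
    exact ⟨fun h => ⟨ρ.length, le_rfl, h⟩, fun ⟨k, hk, h⟩ => (hT hk).1 h⟩
  · ext X
    simp only [mem_Cyl, Set.mem_ofPred_eq, length_tab, hV]
    classical
    trans ∃ n, S (tab O n, tab X n)
    · exact ⟨fun ⟨n, h, _⟩ => ⟨n, h⟩, fun h => ⟨Nat.find h, Nat.find_spec h,
        fun i hi => Nat.find_min h hi⟩⟩
    · simp only [S, length_tab, sR]
      constructor
      · rintro ⟨n, i, hi, h⟩
        exact ⟨i, n, by rwa [take_tab X (by omega)] at h⟩
      · rintro ⟨i, n, h⟩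
        refine ⟨max i n, i, by omega, ?_⟩
        rw [take_tab X (le_max_left _ _)]
        exact mR _ _ _ (le_max_right _ _) h
  · intro X m n hm hn
    simp only [Set.mem_ofPred_eq, length_tab, hV] at hm hn
    by_contra hne
    rcases Nat.lt_or_gt_of_ne hne with h | h
    · exact hn.2 _ h hm.1
    · exact hm.2 _ h hn.1

/-- Concatenations of `m` elements of `V`. -/
def power (V : Set (List Bool)) (m : ℕ) : Set (List Bool) :=
  {ρ | ∃ L : List (List Bool), (L.length = m ∧ L.flatten = ρ) ∧ ∀ x ∈ L, x ∈ V}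

lemma Cyl_power_zero (V : Set (List Bool)) : Cyl (power V 0) = Set.univ := by
  refine Set.eq_univ_of_forall fun X => mem_Cyl.2 ⟨0, [], ⟨rfl, rfl⟩, by simp⟩

lemma mem_Cyl_power_succ {V : Set (List Bool)} {m : ℕ} {X : ℕ → Bool} :
    X ∈ Cyl (power V (m + 1)) ↔ ∃ n, tab X n ∈ V ∧ tail n X ∈ Cyl (power V m) := by
  simp only [mem_Cyl]
  constructor
  · rintro ⟨k, L, ⟨hL, hk⟩, h⟩
    obtain ⟨a, L, rfl⟩ := List.exists_cons_of_length_eq_add_one hL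
    rw [List.flatten_cons] at hk
    have hlen := congrArg List.length hk
    rw [length_tab, List.length_append] at hlen
    rw [← hlen, tab_add] at hk
    obtain ⟨h1, h2⟩ := List.append_inj hk (by simp)
    exact ⟨a.length, h1 ▸ h a List.mem_cons_self, L.flatten.length, L,
      ⟨by simpa using hL, h2⟩, fun x hx => h x (List.mem_cons_of_mem _ hx)⟩
  · rintro ⟨n, hn, k, L, ⟨hL, hk⟩, h⟩
    exact ⟨n + k, tab X n :: L, ⟨by simp [hL], by rw [List.flatten_cons, hk, tab_add]⟩,
      by simpa using ⟨hn, h⟩⟩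

lemma Cyl_power_succ_subset (V : Set (List Bool)) (m : ℕ) :
    Cyl (power V (m + 1)) ⊆ Cyl (power V m) := by
  induction m with
  | zero => simp [Cyl_power_zero]
  | succ m ih =>
    intro X hX
    obtain ⟨n, hn, h⟩ := mem_Cyl_power_succ.1 hX
    exact mem_Cyl_power_succ.2 ⟨n, hn, ih h⟩

lemma measurable_tail (j : ℕ) : Measurable (tail j) :=
  measurable_pi_iff.2 fun n => measurable_pi_apply (j + n)

lemma mu_Cyl_power_le {V : Set (List Bool)} (hV : ∀ X m n, tab X m ∈ V → tab X n ∈ V → m = n)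
    (m : ℕ) : mu (Cyl (power V m)) ≤ mu (Cyl V) ^ m := by
  induction m with
  | zero => simpa using prob_le_one
  | succ m ih =>
    have hdisj : V.PairwiseDisjoint cyl := by
      intro σ hσ τ hτ hne
      refine Set.disjoint_left.2 fun X hX hX' => hne ?_
      have h1 : tab X σ.length = σ := hX
      have h2 : tab X τ.length = τ := hX'
      rw [← h1, ← h2, hV X σ.length τ.length (h1.symm ▸ hσ) (h2.symm ▸ hτ)]
    have hsub : Cyl (power V (m + 1)) ⊆
        ⋃ σ ∈ V, tail σ.length ⁻¹' Cyl (power V m) ∩ cyl σ := by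
      intro X hX
      obtain ⟨n, hn, h⟩ := mem_Cyl_power_succ.1 hX
      simp only [Set.mem_iUnion]
      exact ⟨_, hn, by simpa using h, mem_cyl_tab X n⟩
    calc mu (Cyl (power V (m + 1)))
        ≤ ∑' σ : V, mu (tail (σ : List Bool).length ⁻¹' Cyl (power V m) ∩ cyl σ) :=
          (measure_mono hsub).trans (measure_biUnion_le mu V.to_countable _)
      _ = ∑' σ : V, mu (cyl σ) * mu (Cyl (power V m)) := by
          refine tsum_congr fun σ => ?_
          rw [mu_inter_cyl _ (measurable_tail _ (measurableSet_Cyl _)), mu_cyl,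
            ← Set.preimage_comp, show tail (σ : List Bool).length ∘ cat σ = id from
              funext (tail_cat _), Set.preimage_id]
      _ = mu (Cyl V) * mu (Cyl (power V m)) := by
          rw [ENNReal.tsum_mul_right, Cyl_eq_iUnion V, measure_biUnion V.to_countable hdisj
            fun σ _ => measurableSet_cyl σ]
      _ ≤ mu (Cyl V) ^ (m + 1) := by
          rw [pow_succ']
          gcongr

lemma semi_power {O : ℕ → ℕ} {V : Set (List Bool)} (hV : Semi O (· ∈ V)) (c : ℕ) :
    Semi O fun p : ℕ × List Bool => p.2 ∈ power V (c * p.1) := by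
  refine Semi.exists (p := fun q : List (List Bool) × (ℕ × List Bool) =>
    (q.1.length = c * q.2.1 ∧ q.1.flatten = q.2.2) ∧ ∀ x ∈ q.1, x ∈ V)
    (Semi.and (Semi.of_primrecPred (PrimrecPred.and ?_ ?_)) (hV.forall_mem.comp Primrec.fst))
  · exact Primrec.eq.comp (Primrec.list_length.comp Primrec.fst)
      (Primrec.nat_mul.comp (Primrec.const c) (Primrec.fst.comp Primrec.snd))
  · exact Primrec.eq.comp (Primrec.list_flatten.comp Primrec.fst) (Primrec.snd.comp Primrec.snd)

/-- If all tails of `X` lie in an `A`-c.e. open set of measure less than one, then `X` is not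
random relative to `A`. -/
theorem not_mlRandom_of_tails {A : Set ℕ} {U : Set (ℕ → Bool)} (hU : Sigma1In A U)
    (h1 : mu U < 1) {X : ℕ → Bool} (hX : ∀ j, tail j X ∈ U) : ¬ MLRandom A X := by
  obtain ⟨W, hW, rfl⟩ := hU
  obtain ⟨V, sV, hVW, hV⟩ := exists_prefixFree (ceIn_iff.1 hW)
  rw [← hVW] at h1 hX
  obtain ⟨c, hc⟩ := ((ENNReal.tendsto_pow_atTop_nhds_zero_of_lt_one h1).eventually_le_const
    (show (0 : ENNReal) < 2⁻¹ by simp)).exists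
  refine fun hr => hr (fun n => Cyl (power V (c * n)))
    ⟨fun n => power V (c * n), ceSeqIn_iff.2 (semi_power sV c), fun _ => rfl, fun n => ?_,
      fun n => ?_⟩ (Set.mem_iInter.2 fun n => ?_)
  · exact antitone_nat_of_succ_le (f := fun m => Cyl (power V m)) (Cyl_power_succ_subset V)
      (Nat.mul_le_mul_left c n.le_succ)
  · refine (mu_Cyl_power_le hV _).trans ?_
    rw [pow_mul]
    gcongr
  · generalize c * n = m
    clear hr
    induction m generalizing X with
    | zero => simp [Cyl_power_zero]
    | succ m ih =>
      obtain ⟨k, hk⟩ := mem_Cyl.1 (hX 0)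
      refine mem_Cyl_power_succ.2 ⟨k, by
        rwa [show tail 0 X = X from funext fun n => congrArg X n.zero_add] at hk, ih fun j => ?_⟩
      rw [tail_tail]
      exact hX _

/-- The set of strings extending an element of `W`. -/
def up (W : Set (List Bool)) : Set (List Bool) := {ρ | ∃ m, ρ.take m ∈ W}

lemma semi_up {O : ℕ → ℕ} {α : Type*} [Primcodable α] {W : α → Set (List Bool)}
    (hW : Semi O fun p : α × List Bool => p.2 ∈ W p.1) :
    Semi O fun p : α × List Bool => p.2 ∈ up (W p.1) :=
  (hW.comp (f := fun q : ℕ × (α × List Bool) => (q.2.1, q.2.2.take q.1))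
    (Primrec.pair (Primrec.fst.comp Primrec.snd)
      (Primrec.list_take.comp Primrec.fst (Primrec.snd.comp Primrec.snd)))).exists

lemma append_mem_up {W : Set (List Bool)} {σ : List Bool} (h : σ ∈ up W) (τ : List Bool) :
    σ ++ τ ∈ up W := by
  obtain ⟨m, hm⟩ := h
  refine ⟨min m σ.length, ?_⟩
  rwa [List.take_append_of_le_length (min_le_right _ _), ← List.take_eq_take_min]

lemma Cyl_up (W : Set (List Bool)) : Cyl (up W) = Cyl W := by
  ext X
  simp only [mem_Cyl]
  constructor
  · rintro ⟨n, m, h⟩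
    rw [List.take_eq_take_min, length_tab, take_tab X (min_le_right _ _)] at h
    exact ⟨_, h⟩
  · rintro ⟨n, h⟩
    exact ⟨n, n, by rwa [take_tab X le_rfl]⟩

lemma cat_preimage_Cyl (σ : List Bool) (W : Set (List Bool)) :
    cat σ ⁻¹' Cyl W = Cyl {ρ | σ ++ ρ ∈ up W} := by
  ext X
  rw [Set.mem_preimage, ← Cyl_up, mem_Cyl, mem_Cyl]
  constructor
  · rintro ⟨n, h⟩
    refine ⟨n, ?_⟩
    rw [Set.mem_ofPred_eq, ← tab_cat, Nat.add_comm, tab_add]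
    exact append_mem_up h _
  · rintro ⟨n, h⟩
    exact ⟨σ.length + n, by rwa [tab_cat]⟩

lemma CeIn.up {A : Set ℕ} {W : Set (List Bool)} (hW : CeIn A W) : CeIn A (up W) :=
  ceIn_iff.2 <| (semi_up (W := fun _ : Unit => W) ((ceIn_iff.1 hW).comp Primrec.snd)).comp
    (f := fun ρ => ((), ρ)) (Primrec.pair (Primrec.const ()) Primrec.id)

lemma CeIn.union {A : Set ℕ} {V W : Set (List Bool)} (hV : CeIn A V) (hW : CeIn A W) :
    CeIn A (V ∪ W) :=
  ceIn_iff.2 ((ceIn_iff.1 hV).or (ceIn_iff.1 hW))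

lemma Cyl_union (V W : Set (List Bool)) : Cyl (V ∪ W) = Cyl V ∪ Cyl W := by
  simp only [Cyl_eq_iUnion, Set.biUnion_union]

lemma Pi1In.inter {A : Set ℕ} {P Q : Set (ℕ → Bool)} (hP : Pi1In A P) (hQ : Pi1In A Q) :
    Pi1In A (P ∩ Q) := by
  obtain ⟨V, hV, rfl⟩ := hP
  obtain ⟨W, hW, rfl⟩ := hQ
  exact ⟨V ∪ W, hV.union hW, by rw [Cyl_union, Set.compl_union]⟩

lemma pi1In_cyl (A : Set ℕ) (σ : List Bool) : Pi1In A (cyl σ) := by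
  refine ⟨{ρ | ρ.length = σ.length ∧ ρ ≠ σ}, ceIn_iff.2 (Semi.of_primrecPred ?_), ?_⟩
  · exact (Primrec.eq.comp Primrec.list_length (Primrec.const _)).and
      (Primrec.eq.comp Primrec.id (Primrec.const σ)).not
  · ext X
    rw [Set.mem_compl_iff, mem_Cyl]
    constructor
    · rintro hX ⟨n, h1, h2⟩
      rw [length_tab] at h1
      exact h2 (h1 ▸ hX)
    · intro h
      by_contra hX
      exact h ⟨σ.length, by simp, hX⟩

lemma Pi1In.cat_preimage {A : Set ℕ} {Q : Set (ℕ → Bool)} (hQ : Pi1In A Q) (σ : List Bool) :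
    Pi1In A (cat σ ⁻¹' Q) := by
  obtain ⟨V, hV, rfl⟩ := hQ
  refine ⟨{ρ | σ ++ ρ ∈ LMD.up V}, ceIn_iff.2 ?_, ?_⟩
  · exact (ceIn_iff.1 hV.up).comp (Primrec.list_append.comp (Primrec.const σ) Primrec.id)
  · rw [← cat_preimage_Cyl, Set.preimage_compl]

lemma Pi1In.measurableSet {A : Set ℕ} {Q : Set (ℕ → Bool)} (hQ : Pi1In A Q) :
    MeasurableSet Q := by
  obtain ⟨V, _, rfl⟩ := hQ
  exact (measurableSet_Cyl V).compl

lemma Pi1In.isClosed {A : Set ℕ} {Q : Set (ℕ → Bool)} (hQ : Pi1In A Q) : IsClosed Q := by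
  obtain ⟨V, _, rfl⟩ := hQ
  exact (isOpen_Cyl V).isClosed_compl

section Thin

open Classical in
/-- The number of strings `ρ` of length `d` such that `τ ++ ρ` is not in the stage `t` of `R`. -/
noncomputable def survivors (R : List ℕ × List Bool → Prop) (t : List ℕ) (τ : List Bool)
    (d : ℕ) : ℕ :=
  ((strings d).filter fun ρ => ¬ R (t, τ ++ ρ)).length

variable {O : ℕ → ℕ} {R : List ℕ × List Bool → Prop}

lemma primrec_survivors (pR : PrimrecPred R) :
    Primrec fun q : List ℕ × (ℕ × List Bool) => survivors R q.1 q.2.2 q.2.1 := by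
  classical
  have h : PrimrecRel fun (ρ : List Bool) (q : List ℕ × (ℕ × List Bool)) =>
      ¬ R (q.1, q.2.2 ++ ρ) :=
    (pR.comp (Primrec.pair (Primrec.fst.comp Primrec.snd) (Primrec.list_append.comp
      (Primrec.snd.comp (Primrec.snd.comp Primrec.snd)) Primrec.fst))).not
  exact Primrec.list_length.comp (h.listFilter.comp
    (primrec_strings.comp (Primrec.fst.comp Primrec.snd)) Primrec.id)

lemma mu_survivors (R : List ℕ × List Bool → Prop) (t : List ℕ) (τ : List Bool) (d : ℕ) :
    mu {Y | ¬ R (t, τ ++ tab Y d)} = survivors R t τ d * 2⁻¹ ^ d := by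
  classical
  rw [mu_tab fun ρ => ¬ R (t, τ ++ ρ), survivors]

lemma natCast_mul_inv_two_pow_le {s a b : ℕ} :
    (s : ENNReal) * 2⁻¹ ^ a ≤ 2⁻¹ ^ b ↔ s * 2 ^ b ≤ 2 ^ a := by
  rw [← ENNReal.inv_pow, ← ENNReal.inv_pow, ← div_eq_mul_inv,
    ENNReal.div_le_iff (by simp) (by simp [ENNReal.pow_eq_top_iff]), mul_comm, ← div_eq_mul_inv,
    ENNReal.le_div_iff_mul_le (by simp) (by simp [ENNReal.pow_eq_top_iff])]
  exact_mod_cast Iff.rfl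

/-- Strings above which the complement of the open set enumerated by `R` is seen to have small
measure. -/
def thin (O : ℕ → ℕ) (R : List ℕ × List Bool → Prop) (K : ℕ) : Set (List Bool) :=
  {τ | ∃ d k, survivors R (tab O k) τ d * 2 ^ (K + Encodable.encode τ) ≤ 2 ^ (τ.length + d)}

lemma semi_thin (pR : PrimrecPred R) (mR : ∀ a j k, j ≤ k → R (tab O j, a) → R (tab O k, a))
    (K : ℕ) : Semi O (· ∈ thin O R K) := by
  have pow : Primrec fun n : ℕ => 2 ^ n :=
    (Primrec₂.unpaired'.1 Nat.Primrec.pow).comp (Primrec.const 2) Primrec.id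
  refine Semi.exists (p := fun q : ℕ × List Bool => ∃ k,
    survivors R (tab O k) q.2 q.1 * 2 ^ (K + Encodable.encode q.2) ≤ 2 ^ (q.2.length + q.1))
    ⟨fun q => survivors R q.1 q.2.2 q.2.1 * 2 ^ (K + Encodable.encode q.2.2) ≤
      2 ^ (q.2.2.length + q.2.1), ?_, ?_, fun _ => Iff.rfl⟩
  · exact Primrec.nat_le.comp (Primrec.nat_mul.comp (primrec_survivors pR)
      (pow.comp (Primrec.nat_add.comp (Primrec.const K)
        (Primrec.encode.comp (Primrec.snd.comp Primrec.snd)))))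
      (pow.comp (Primrec.nat_add.comp
        (Primrec.list_length.comp (Primrec.snd.comp Primrec.snd))
        (Primrec.fst.comp Primrec.snd)))
  · intro q j k hjk h
    refine le_trans (Nat.mul_le_mul_right _ ?_) h
    refine (List.monotone_filter_right _ fun ρ hρ => ?_).length_le
    simp only [decide_eq_true_eq] at hρ ⊢
    exact fun h => hρ (mR _ _ _ hjk h)

lemma mu_compl_inter_cyl_le {V : Set (List Bool)} (sR : ∀ ρ, ρ ∈ V ↔ ∃ k, R (tab O k, ρ))
    {K : ℕ} {τ : List Bool} (hτ : τ ∈ thin O R K) :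
    mu ((Cyl V)ᶜ ∩ cyl τ) ≤ 2⁻¹ ^ (K + Encodable.encode τ) := by
  obtain ⟨d, k, h⟩ := hτ
  have hsub : cat τ ⁻¹' (Cyl V)ᶜ ⊆ {Y | ¬ R (tab O k, τ ++ tab Y d)} := by
    intro Y hY hR
    exact hY (mem_Cyl.2 ⟨τ.length + d, (sR _).2 ⟨k, by rwa [tab_cat]⟩⟩)
  calc mu ((Cyl V)ᶜ ∩ cyl τ)
      ≤ 2⁻¹ ^ τ.length * (survivors R (tab O k) τ d * 2⁻¹ ^ d) := by
        rw [mu_inter_cyl τ (measurableSet_Cyl V).compl, ← mu_survivors]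
        gcongr
    _ = survivors R (tab O k) τ d * 2⁻¹ ^ (τ.length + d) := by
        rw [pow_add, mul_left_comm]
    _ ≤ 2⁻¹ ^ (K + Encodable.encode τ) := natCast_mul_inv_two_pow_le.2 h

lemma mem_thin {V : Set (List Bool)} (hV : ∀ σ ∈ V, ∀ τ, σ ++ τ ∈ V)
    (mR : ∀ a j k, j ≤ k → R (tab O j, a) → R (tab O k, a))
    (sR : ∀ ρ, ρ ∈ V ↔ ∃ k, R (tab O k, ρ)) (K : ℕ) {τ : List Bool}
    (hτ : mu ((Cyl V)ᶜ ∩ cyl τ) = 0) : τ ∈ thin O R K := by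
  rw [mu_inter_cyl τ (measurableSet_Cyl V).compl] at hτ
  have hnull : mu (cat τ ⁻¹' (Cyl V)ᶜ) = 0 := by
    refine (mul_eq_zero.1 hτ).resolve_left (by simp)
  let H : ℕ → Set (ℕ → Bool) := fun d => {Y | τ ++ tab Y d ∉ V}
  have hH : Antitone H := by
    refine antitone_nat_of_succ_le fun d Y hY hY' => hY ?_
    rw [tab_add, ← List.append_assoc]
    exact hV _ hY' _
  have hInter : ⋂ d, H d ⊆ cat τ ⁻¹' (Cyl V)ᶜ := by
    intro Y hY hY'
    obtain ⟨n, hn⟩ := mem_Cyl.1 hY'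
    refine Set.mem_iInter.1 hY n ?_
    rw [← tab_cat, Nat.add_comm, tab_add]
    exact hV _ hn _
  have hlim := tendsto_measure_iInter_atTop (μ := mu) (s := H)
    (fun d => (measurableSet_tab (fun ρ => τ ++ ρ ∉ V) d).nullMeasurableSet) hH
    ⟨0, measure_ne_top _ _⟩
  rw [measure_mono_null hInter hnull] at hlim
  obtain ⟨d, hd⟩ := (hlim.eventually_le_const
    (show (0 : ENNReal) < 2⁻¹ ^ (K + Encodable.encode τ) by simp [pos_iff_ne_zero])).exists
  obtain ⟨k, hk⟩ := exists_stage_forall_mem (R := fun k ρ => τ ++ ρ ∈ V → R (tab O k, τ ++ ρ))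
    (fun ρ i j hij h h' => mR _ _ _ hij (h h')) (strings d) fun ρ _ => by
      by_cases h : τ ++ ρ ∈ V
      · obtain ⟨k, hk⟩ := (sR _).1 h
        exact ⟨k, fun _ => hk⟩
      · exact ⟨0, fun h' => absurd h' h⟩
  have hle : mu {Y | ¬ R (tab O k, τ ++ tab Y d)} ≤ 2⁻¹ ^ (K + Encodable.encode τ) :=
    (measure_mono fun Y (hY : ¬ _) h => hY (hk _ (mem_strings.2 (by simp)) h)).trans hd
  rw [mu_survivors, natCast_mul_inv_two_pow_le] at hle
  exact ⟨d, k, hle.trans (Nat.pow_le_pow_right two_pos (Nat.le_add_left _ _))⟩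

lemma mu_compl_inter_Cyl_thin_le {V : Set (List Bool)}
    (sR : ∀ ρ, ρ ∈ V ↔ ∃ k, R (tab O k, ρ)) (K : ℕ) :
    mu ((Cyl V)ᶜ ∩ Cyl (thin O R K)) ≤ 2⁻¹ ^ K * 2 := by
  rw [Cyl_eq_iUnion (thin O R K), Set.inter_iUnion₂]
  calc mu (⋃ τ ∈ thin O R K, (Cyl V)ᶜ ∩ cyl τ)
      ≤ ∑' τ : thin O R K, mu ((Cyl V)ᶜ ∩ cyl τ) :=
        measure_biUnion_le mu (Set.to_countable _) _
    _ ≤ ∑' τ : thin O R K, 2⁻¹ ^ K * 2⁻¹ ^ Encodable.encode (τ : List Bool) :=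
        ENNReal.tsum_le_tsum fun τ => (mu_compl_inter_cyl_le sR τ.2).trans_eq (pow_add _ _ _)
    _ ≤ 2⁻¹ ^ K * ∑' n : ℕ, 2⁻¹ ^ n := by
        rw [ENNReal.tsum_mul_left]
        gcongr
        exact ENNReal.tsum_comp_le_tsum_of_injective
          (Encodable.encode_injective.comp Subtype.val_injective) fun n => 2⁻¹ ^ n
    _ = 2⁻¹ ^ K * 2 := by rw [ENNReal.tsum_geometric, ENNReal.one_sub_inv_two, inv_inv]

end Thin

/-- A `Π¹` class of positive measure has a subclass of positive measure that avoids all cylinders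
in which the given class is null. -/
theorem Pi1In.exists_subset_inter_cyl_eq_empty {B : Set ℕ} {Q : Set (ℕ → Bool)} (hQ : Pi1In B Q)
    (h0 : 0 < mu Q) : ∃ Q', Pi1In B Q' ∧ Q' ⊆ Q ∧ 0 < mu Q' ∧
      ∀ τ, mu (Q ∩ cyl τ) = 0 → Q' ∩ cyl τ = ∅ := by
  obtain ⟨V₀, hV₀, rfl⟩ := hQ
  rw [← Cyl_up] at h0 ⊢
  have hV := hV₀.up
  have hup : ∀ σ ∈ up V₀, ∀ τ, σ ++ τ ∈ up V₀ := fun σ h τ => append_mem_up h τ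
  generalize up V₀ = V at h0 hV hup
  obtain ⟨R, pR, mR, sR⟩ := ceIn_iff.1 hV
  obtain ⟨K, hK⟩ : ∃ K : ℕ, (2⁻¹ : ENNReal) ^ K * 2 < mu (Cyl V)ᶜ := by
    obtain ⟨K, hK⟩ := ((ENNReal.tendsto_pow_atTop_nhds_zero_of_lt_one
      (show (2⁻¹ : ENNReal) < 1 by simp)).eventually_lt_const h0).exists
    refine ⟨K + 1, ?_⟩
    rwa [pow_succ, mul_assoc, ENNReal.inv_mul_cancel (by simp) (by simp), mul_one]
  have hN : CeIn B (thin (chi B) R K) := ceIn_iff.2 (semi_thin pR mR K)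
  refine ⟨(Cyl (V ∪ thin (chi B) R K))ᶜ, ⟨_, hV.union hN, rfl⟩, ?_, ?_, fun τ hτ => ?_⟩
  · rw [Cyl_union, Set.compl_union]
    exact Set.inter_subset_left
  · rw [Cyl_union, Set.compl_union, ← Set.sdiff_eq, pos_iff_ne_zero]
    intro h
    have := measure_le_inter_add_sdiff mu (Cyl V)ᶜ (Cyl (thin (chi B) R K))
    rw [h, add_zero] at this
    exact absurd (this.trans (mu_compl_inter_Cyl_thin_le sR K)) (not_le.2 hK)
  · have h : τ ∈ V ∪ thin (chi B) R K := Or.inr (mem_thin hup mR sR K hτ)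
    refine Set.eq_empty_of_forall_notMem fun X hX => hX.1 (mem_Cyl.2 ⟨τ.length, ?_⟩)
    rwa [show tab X τ.length = τ from hX.2]

/-- A Martin-Löf test yields an open class of measure less than one containing every tail of
every sequence captured by the test. -/
lemma MLTest.exists_sigma1 {A : Set ℕ} {U : ℕ → Set (ℕ → Bool)} (hU : MLTest A U) :
    ∃ S, Sigma1In A S ∧ mu S < 1 ∧ ∀ X ∈ ⋂ n, U n, ∀ j, tail j X ∈ S := by
  obtain ⟨W, hW, hUW, -, hmu⟩ := hU
  let m : List Bool → ℕ := fun σ => σ.length + (Encodable.encode σ + 2)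
  have hm : Primrec m := Primrec.nat_add.comp Primrec.list_length
    (Primrec.nat_add.comp Primrec.encode (Primrec.const 2))
  have hS : Cyl {ρ | ∃ σ, σ ++ ρ ∈ up (W (m σ))} = ⋃ σ, cat σ ⁻¹' U (m σ) := by
    simp only [hUW, cat_preimage_Cyl]
    ext X
    simp only [mem_Cyl, Set.mem_iUnion, Set.mem_ofPred_eq]
    exact exists_comm
  refine ⟨_, ⟨{ρ | ∃ σ, σ ++ ρ ∈ up (W (m σ))}, ceIn_iff.2 ?_, rfl⟩, ?_, ?_⟩
  · exact Semi.exists (p := fun q : List Bool × List Bool => q.1 ++ q.2 ∈ up (W (m q.1)))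
      ((semi_up (ceSeqIn_iff.1 hW)).comp (f := fun q : List Bool × List Bool =>
        (m q.1, q.1 ++ q.2)) (Primrec.pair (hm.comp Primrec.fst) Primrec.list_append))
  · rw [hS]
    have hσ : ∀ σ, mu (cat σ ⁻¹' U (m σ)) ≤ 2⁻¹ ^ (Encodable.encode σ + 2) := by
      intro σ
      have hmeas : MeasurableSet (U (m σ)) := hUW (m σ) ▸ measurableSet_Cyl _
      have h : mu (U (m σ) ∩ cyl σ) ≤ 2⁻¹ ^ m σ :=
        (measure_mono Set.inter_subset_left).trans (hmu (m σ))
      rw [mu_inter_cyl σ hmeas, pow_add 2⁻¹ σ.length] at h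
      exact (ENNReal.mul_le_mul_iff_right (by simp) (by simp [ENNReal.pow_eq_top_iff])).1 h
    calc mu (⋃ σ, cat σ ⁻¹' U (m σ))
        ≤ ∑' σ, mu (cat σ ⁻¹' U (m σ)) := measure_iUnion_le _
      _ ≤ ∑' σ : List Bool, 2⁻¹ ^ Encodable.encode σ * 2⁻¹ ^ 2 :=
          ENNReal.tsum_le_tsum fun σ => (hσ σ).trans_eq (pow_add _ _ _)
      _ ≤ (∑' n : ℕ, 2⁻¹ ^ n) * 2⁻¹ ^ 2 := by
          rw [ENNReal.tsum_mul_right]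
          gcongr
          exact ENNReal.tsum_comp_le_tsum_of_injective Encodable.encode_injective fun n => 2⁻¹ ^ n
      _ = 2⁻¹ := by
          rw [ENNReal.tsum_geometric, ENNReal.one_sub_inv_two, inv_inv, pow_two, ← mul_assoc,
            ENNReal.mul_inv_cancel (by simp) (by simp), one_mul]
      _ < 1 := by simp
  · intro X hX j
    rw [hS]
    refine Set.mem_iUnion.2 ⟨tab X j, ?_⟩
    rw [Set.mem_preimage, cat_tab_tail]
    exact Set.mem_iInter.1 hX _

theorem LRle.of_forall_pi1 {A B : Set ℕ}
    (h : ∀ P, Pi1In A P → 0 < mu P → ∃ Q, Pi1In B Q ∧ Q ⊆ P ∧ 0 < mu Q) : LRle A B := by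
  intro X hX U hU hXU
  obtain ⟨S, ⟨W, hW, rfl⟩, hS1, hS⟩ := hU.exists_sigma1
  obtain ⟨Q, ⟨V, hV, rfl⟩, hQS, hQ0⟩ := h (Cyl W)ᶜ ⟨W, hW, rfl⟩ (by
    rwa [prob_compl_eq_one_sub (measurableSet_Cyl W), tsub_pos_iff_lt])
  refine not_mlRandom_of_tails ⟨V, hV, rfl⟩ ?_
    (fun j => Set.compl_subset_compl.1 hQS (hS X hXU j)) hX
  rwa [prob_compl_eq_one_sub (measurableSet_Cyl V), tsub_pos_iff_lt] at hQ0

/-- If the complement of `Cyl W` has no `Π¹` subclass of positive measure, then every `Π¹` class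
of positive measure can be shrunk so that a given tail is in `Cyl W`. -/
lemma Pi1In.exists_subset_tail_mem {B : Set ℕ} {W : Set (List Bool)}
    (hW : ∀ Q, Pi1In B Q → Q ⊆ (Cyl W)ᶜ → mu Q = 0) {Q : Set (ℕ → Bool)} (hQ : Pi1In B Q)
    (h0 : 0 < mu Q) (j : ℕ) :
    ∃ Q', Pi1In B Q' ∧ Q' ⊆ Q ∧ 0 < mu Q' ∧ ∀ X ∈ Q', tail j X ∈ Cyl W := by
  obtain ⟨σ, rfl, hσ⟩ : ∃ σ : List Bool, σ.length = j ∧ mu (Q ∩ cyl σ) ≠ 0 := by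
    by_contra! hnull
    refine h0.ne' (measure_mono_null (t := ⋃ σ ∈ {σ : List Bool | σ.length = j}, Q ∩ cyl σ)
      (fun X hX => ?_) ((measure_biUnion_null_iff (Set.to_countable _)).2 hnull))
    simp only [Set.mem_iUnion]
    exact ⟨tab X j, length_tab X j, hX, mem_cyl_tab X j⟩
  have hQ1 := hQ.cat_preimage σ
  have h1 : 0 < mu (cat σ ⁻¹' Q) := by
    rw [mu_inter_cyl σ hQ.measurableSet] at hσ
    exact pos_iff_ne_zero.2 (right_ne_zero_of_mul hσ)
  obtain ⟨τ, hτ, h2⟩ : ∃ τ ∈ W, mu (cat σ ⁻¹' Q ∩ cyl τ) ≠ 0 := by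
    by_contra! hnull
    obtain ⟨Q', hQ', -, hpos, hempty⟩ := hQ1.exists_subset_inter_cyl_eq_empty h1
    refine hpos.ne' (hW Q' hQ' fun X hX hXW => ?_)
    rw [Cyl_eq_iUnion] at hXW
    simp only [Set.mem_iUnion] at hXW
    obtain ⟨τ, hτ, hXτ⟩ := hXW
    exact (hempty τ (hnull τ hτ)).subset ⟨hX, hXτ⟩
  have hpre : cat σ ⁻¹' (tail σ.length ⁻¹' cyl τ) = cyl τ := by
    rw [← Set.preimage_comp, show tail σ.length ∘ cat σ = id from funext (tail_cat σ),
      Set.preimage_id]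
  have hcyl : cyl (σ ++ τ) = tail σ.length ⁻¹' cyl τ ∩ cyl σ := by
    ext X
    simp only [cyl, Set.mem_ofPred_eq, Set.mem_inter_iff, Set.mem_preimage, List.length_append,
      tab_add]
    constructor
    · exact fun h => (List.append_inj h (by simp)).symm
    · rintro ⟨h, h'⟩
      rw [h, h']
  refine ⟨Q ∩ cyl (σ ++ τ), hQ.inter (pi1In_cyl B _), Set.inter_subset_left, ?_, ?_⟩
  · rw [hcyl, ← Set.inter_assoc, mu_inter_cyl σ
      (hQ.measurableSet.inter (measurable_tail _ (measurableSet_cyl τ))), Set.preimage_inter, hpre]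
    exact ENNReal.mul_pos (by simp) h2
  · rintro X ⟨-, hX⟩
    rw [hcyl] at hX
    rw [Cyl_eq_iUnion]
    exact Set.mem_biUnion hτ hX.1

lemma Pi1In.exists_subset_avoiding {B : Set ℕ} {Q : Set (ℕ → Bool)} (hQ : Pi1In B Q)
    (h0 : 0 < mu Q) (U : ℕ → Set (ℕ → Bool)) :
    ∃ Q', Pi1In B Q' ∧ Q' ⊆ Q ∧ 0 < mu Q' ∧ (MLTest B U → Disjoint Q' (⋂ n, U n)) := by
  by_cases hU : MLTest B U
  swap
  · exact ⟨Q, hQ, subset_rfl, h0, fun h => absurd h hU⟩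
  obtain ⟨W, hW, hUW, -, hmu⟩ := hU
  obtain ⟨n, hn⟩ := ((ENNReal.tendsto_pow_atTop_nhds_zero_of_lt_one
      (show (2⁻¹ : ENNReal) < 1 by simp)).eventually_lt_const h0).exists
  have hWn : CeIn B (W n) := ceIn_iff.2 ((ceSeqIn_iff.1 hW).comp
    (f := fun σ => (n, σ)) (Primrec.pair (Primrec.const n) Primrec.id))
  refine ⟨Q ∩ (U n)ᶜ, hQ.inter ⟨W n, hWn, by rw [hUW]⟩, Set.inter_subset_left, ?_,
    fun _ => Set.disjoint_left.2 fun X hX hXU => hX.2 (Set.mem_iInter.1 hXU n)⟩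
  rw [← Set.sdiff_eq, pos_iff_ne_zero]
  intro h
  have hle := measure_le_inter_add_sdiff mu Q (U n)
  rw [h, add_zero] at hle
  exact absurd ((hle.trans (measure_mono Set.inter_subset_right)).trans (hmu n)) (not_le.2 hn)

/-- All Martin-Löf tests appear in one sequence. -/
lemma exists_seq_mlTest (B : Set ℕ) :
    ∃ N : ℕ → ℕ → Set (ℕ → Bool), ∀ U, MLTest B U → ∃ n, N n = U := by
  obtain ⟨e, he⟩ := exists_surjective_nat OracleCode
  refine ⟨fun n i => Cyl {σ | ((e n).eval (chi B) (Nat.pair i (Encodable.encode σ))).Dom}, ?_⟩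
  rintro U ⟨W, ⟨c, hc⟩, hUW, -⟩
  obtain ⟨n, rfl⟩ := he c
  refine ⟨n, funext fun i => ?_⟩
  rw [hUW]
  exact congrArg Cyl (Set.ext fun σ => (hc i σ).symm)

theorem LRle.exists_pi1 {A B : Set ℕ} (h : LRle A B) {P : Set (ℕ → Bool)} (hP : Pi1In A P)
    (h0 : 0 < mu P) : ∃ Q, Pi1In B Q ∧ Q ⊆ P ∧ 0 < mu Q := by
  by_contra! hcon
  obtain ⟨W, hW, rfl⟩ := hP
  obtain ⟨N, hN⟩ := exists_seq_mlTest B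
  have step : ∀ (n : ℕ) (Q : {Q : Set (ℕ → Bool) // Pi1In B Q ∧ 0 < mu Q}),
      ∃ Q' : {Q : Set (ℕ → Bool) // Pi1In B Q ∧ 0 < mu Q}, Q'.1 ⊆ Q.1 ∧
        ∀ X ∈ Q'.1, (MLTest B (N n) → X ∉ ⋂ i, N n i) ∧ tail n X ∈ Cyl W := by
    rintro n ⟨Q, hQ, hQ0⟩
    obtain ⟨Q₁, hQ₁, hsub₁, hpos₁, hdisj⟩ := hQ.exists_subset_avoiding hQ0 (N n)
    obtain ⟨Q₂, hQ₂, hsub₂, hpos₂, htail⟩ := hQ₁.exists_subset_tail_mem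
      (fun Q hQ hQW => nonpos_iff_eq_zero.1 (hcon Q hQ hQW)) hpos₁ n
    exact ⟨⟨Q₂, hQ₂, hpos₂⟩, hsub₂.trans hsub₁, fun X hX =>
      ⟨fun h => Set.disjoint_left.1 (hdisj h) (hsub₂ hX), htail X hX⟩⟩
  choose f hsub hf using step
  let Q : ℕ → {Q : Set (ℕ → Bool) // Pi1In B Q ∧ 0 < mu Q} := fun n =>
    n.rec ⟨Set.univ, ⟨∅, ceIn_iff.2 ((Semi.of_primrecPred (PrimrecPred.of_eq
      (Primrec.eq.comp (Primrec.const 0) (Primrec.const 1)) (by simp)))), by simp [Cyl]⟩,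
      by simp⟩ f
  obtain ⟨X, hX⟩ := IsCompact.nonempty_iInter_of_sequence_nonempty_isCompact_isClosed
    (fun n => (Q n).1) (fun n => hsub n (Q n))
    (fun n => nonempty_of_measure_ne_zero (Q n).2.2.ne') (Q 0).2.1.isClosed.isCompact
    fun n => (Q n).2.1.isClosed
  have hX' : ∀ n, (MLTest B (N n) → X ∉ ⋂ i, N n i) ∧ tail n X ∈ Cyl W := fun n =>
    hf n (Q n) X (Set.mem_iInter.1 hX (n + 1))
  refine not_mlRandom_of_tails ⟨W, hW, rfl⟩ ?_ (fun j => (hX' j).2)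
    (h X fun U hU => ?_)
  · rwa [prob_compl_eq_one_sub (measurableSet_Cyl W), tsub_pos_iff_lt] at h0
  · obtain ⟨n, rfl⟩ := hN U hU
    exact (hX' n).1 hU

/-- `A ≤_LR B` iff every `Π^A_1` class of positive measure has a `Π^B_1` subclass of
positive measure. -/
theorem lr_iff_pi1_subclass (A B : Set ℕ) :
    LRle A B ↔
      ∀ P : Set (ℕ → Bool), Pi1In A P → 0 < mu P →
        ∃ Q : Set (ℕ → Bool), Pi1In B Q ∧ Q ⊆ P ∧ 0 < mu Q := by
  exact ⟨fun h _ hP h0 => h.exists_pi1 hP h0, LRle.of_forall_pi1⟩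

end LMD
end

section
/- There is a computable G_δ set G ⊆ 2^ω such that the set of rationals {q ∈ ℚ : μ(G) ≥ q} is not a Σ⁰₂ subset of ℚ. -/
open MeasureTheory Filter

namespace LMD

/-- `W` codes a computable `G_δ` set: the relation `σ ∈ W k` is computable in `(k, σ)`. -/
def ComputableCode (W : ℕ → Set (List Bool)) : Prop :=
  ∃ g : ℕ → List Bool → Bool, Computable₂ g ∧ ∀ (k : ℕ) (σ : List Bool), σ ∈ W k ↔ g k σ = true

/-- Sequences whose first `n` entries vanish. -/
def zeroCyl (n : ℕ) : Set (ℕ → Bool) := {X | ∀ j < n, X j = false}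

/-- Sequences whose first nonzero entry is at position `n`. -/
def firstOne (n : ℕ) : Set (ℕ → Bool) := {X | X ∈ zeroCyl n ∧ X n = true}

theorem firstOne_eq_diff (n : ℕ) : firstOne n = zeroCyl n \ zeroCyl (n + 1) := by
  ext X
  simp only [firstOne, zeroCyl, Set.mem_ofPred_eq, Set.mem_sdiff, and_congr_right_iff]
  intro h
  constructor
  · intro h1 h2
    simp [h2 n (Nat.lt_succ_self n)] at h1
  · intro h1
    by_contra h2
    refine h1 fun j hj => ?_
    rcases Nat.lt_succ_iff_lt_or_eq.1 hj with h3 | rfl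
    · exact h j h3
    · simpa using h2

theorem firstOne_unique {X : ℕ → Bool} {m n : ℕ} (hm : X ∈ firstOne m) (hn : X ∈ firstOne n) :
    m = n := by
  rcases lt_trichotomy m n with h | h | h
  · simpa [hm.2] using hn.1 m h
  · exact h
  · simpa [hn.2] using hm.1 n h

theorem zeroCyl_anti : Antitone zeroCyl := fun _ _ hmn _ hX j hj => hX j (hj.trans_le hmn)

theorem measurableSet_zeroCyl (n : ℕ) : MeasurableSet (zeroCyl n) := by
  have : zeroCyl n = ⋂ j, ⋂ (_ : j < n), (fun X : ℕ → Bool => X j) ⁻¹' {false} := by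
    ext X; simp [zeroCyl]
  rw [this]
  exact MeasurableSet.iInter fun j => MeasurableSet.iInter fun _ =>
    measurable_pi_apply j (MeasurableSet.singleton _)

theorem measurableSet_firstOne (n : ℕ) : MeasurableSet (firstOne n) := by
  rw [firstOne_eq_diff]
  exact (measurableSet_zeroCyl n).diff (measurableSet_zeroCyl _)

theorem measurable_binaryExpansion :
    Measurable (fun (x : ℝ) (n : ℕ) => decide (⌊x * 2 ^ (n + 1)⌋₊ % 2 = 1)) := by
  refine measurable_pi_iff.2 fun n => ?_
  exact (measurable_from_top (f := fun k : ℕ => decide (k % 2 = 1))).comp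
    (Nat.measurable_floor.comp (measurable_id.mul_const _))

theorem binaryExpansion_mem_zeroCyl {x : ℝ} (hx : x ∈ Set.Ico (0 : ℝ) 1) (n : ℕ) :
    (fun n : ℕ => decide (⌊x * 2 ^ (n + 1)⌋₊ % 2 = 1)) ∈ zeroCyl n ↔ x * 2 ^ n < 1 := by
  simp only [zeroCyl, Set.mem_ofPred_eq, decide_eq_false_iff_not]
  induction n with
  | zero => simpa using hx.2
  | succ n ih =>
    constructor
    · intro h
      have h1 := ih.1 fun j hj => h j (by omega)
      have h2 := h n (by omega)
      have h3 : ⌊x * 2 ^ (n + 1)⌋₊ < 2 := by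
        rw [Nat.floor_lt (mul_nonneg hx.1 (by positivity))]
        rw [pow_succ]; push_cast; linarith
      have h4 : ⌊x * 2 ^ (n + 1)⌋₊ = 0 := by omega
      exact Nat.floor_eq_zero.1 h4
    · intro h j hj
      have h1 : x * 2 ^ (j + 1) < 1 := lt_of_le_of_lt
        (mul_le_mul_of_nonneg_left (pow_le_pow_right₀ (by norm_num) hj) hx.1) h
      simp [Nat.floor_eq_zero.2 h1]

theorem mu_zeroCyl (n : ℕ) : mu (zeroCyl n) = ENNReal.ofReal ((1 / 2) ^ n) := by
  have h2 : (0 : ℝ) < 2 ^ n := by positivity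
  have h3 : (1 / 2 : ℝ) ^ n ≤ 1 := pow_le_one₀ (by norm_num) (by norm_num)
  have h4 : (1 / 2 : ℝ) ^ n = 1 / 2 ^ n := by rw [div_pow, one_pow]
  rw [mu, Measure.map_apply measurable_binaryExpansion (measurableSet_zeroCyl n),
    Measure.restrict_apply (measurable_binaryExpansion (measurableSet_zeroCyl n))]
  have : ((fun (x : ℝ) (n : ℕ) => decide (⌊x * 2 ^ (n + 1)⌋₊ % 2 = 1)) ⁻¹' zeroCyl n)
      ∩ Set.Ico 0 1 = Set.Ico 0 ((1 / 2) ^ n) := by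
    ext x
    simp only [Set.mem_inter_iff, Set.mem_preimage]
    constructor
    · rintro ⟨h, hx⟩
      rw [binaryExpansion_mem_zeroCyl hx] at h
      exact ⟨hx.1, by rwa [h4, lt_div_iff₀ h2]⟩
    · intro h
      have hx : x ∈ Set.Ico (0 : ℝ) 1 := ⟨h.1, h.2.trans_le h3⟩
      refine ⟨(binaryExpansion_mem_zeroCyl hx n).2 ?_, hx⟩
      rw [← lt_div_iff₀ h2, ← h4]
      exact h.2
  rw [this]
  simp

instance isProbabilityMeasure_mu : IsProbabilityMeasure mu where
  measure_univ := by
    have : (Set.univ : Set (ℕ → Bool)) = zeroCyl 0 := by simp [zeroCyl]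
    rw [this, mu_zeroCyl]
    simp

theorem mu_real_zeroCyl (n : ℕ) : mu.real (zeroCyl n) = (1 / 2) ^ n := by
  rw [Measure.real, mu_zeroCyl, ENNReal.toReal_ofReal (by positivity)]

theorem mu_real_firstOne (n : ℕ) : mu.real (firstOne n) = (1 / 2) ^ (n + 1) := by
  rw [firstOne_eq_diff, measureReal_sdiff (zeroCyl_anti (Nat.le_add_right n 1))
    (measurableSet_zeroCyl _), mu_real_zeroCyl, mu_real_zeroCyl]
  ring

theorem sum_le_mu_real_iUnion {B : Set ℕ} {p : ℕ → Prop} [DecidablePred p] {j : ℕ}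
    (hp : ∀ i < j, p i → i ∈ B) (hj : j ∈ B) :
    (∑ i ∈ Finset.range j, if p i then (1 / 2 : ℝ) ^ (i + 1) else 0) + (1 / 2) ^ (j + 1) ≤
      mu.real (⋃ i ∈ B, firstOne i) := by
  have hn : j ∉ (Finset.range j).filter p := by simp
  have h := measureReal_biUnion_finset (μ := mu)
    (s := insert j ((Finset.range j).filter p)) (f := firstOne)
    (fun a _ b _ hab => Set.disjoint_left.2 fun X ha hb => hab (firstOne_unique ha hb))
    (fun b _ => measurableSet_firstOne b)
  rw [Finset.sum_insert hn, Finset.sum_filter] at h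
  simp only [mu_real_firstOne] at h
  rw [add_comm, ← h]
  refine measureReal_mono (Set.iUnion₂_subset fun i hi => ?_) (measure_ne_top _ _)
  refine Set.subset_biUnion_of_mem (u := firstOne) ?_
  simp only [Finset.mem_insert, Finset.mem_filter, Finset.mem_range] at hi
  rcases hi with rfl | hi
  · exact hj
  · exact hp i hi.1 hi.2

theorem mu_real_iUnion_lt {B : Set ℕ} {p : ℕ → Prop} [DecidablePred p] {j : ℕ}
    (hp : ∀ i < j, i ∈ B → p i) (hj : j ∉ B) (hj' : j + 1 ∉ B) :
    mu.real (⋃ i ∈ B, firstOne i) <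
      (∑ i ∈ Finset.range j, if p i then (1 / 2 : ℝ) ^ (i + 1) else 0) + (1 / 2) ^ (j + 1) := by
  have hsub : (⋃ i ∈ B, firstOne i) ⊆
      (⋃ i ∈ (Finset.range j).filter p, firstOne i) ∪ zeroCyl (j + 2) := by
    refine Set.iUnion₂_subset fun i hi X hX => ?_
    by_cases hij : i < j
    · left
      simp only [Set.mem_iUnion]
      exact ⟨i, by simp [hij, hp i hij hi], hX⟩
    · right
      have h1 : i ≠ j := fun h => hj (h ▸ hi)
      have h2 : i ≠ j + 1 := fun h => hj' (h ▸ hi)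
      exact fun l hl => hX.1 l (by omega)
  have h1 := (measureReal_mono (μ := mu) hsub).trans (measureReal_union_le _ _)
  have h2 := measureReal_biUnion_finset_le (μ := mu) ((Finset.range j).filter p) firstOne
  rw [Finset.sum_filter] at h2
  simp only [mu_real_firstOne] at h2
  rw [mu_real_zeroCyl] at h1
  have h3 : (1 / 2 : ℝ) ^ (j + 2) < (1 / 2) ^ (j + 1) :=
    pow_lt_pow_right_of_lt_one₀ (by norm_num) (by norm_num) (by omega)
  linarith

/-- Strings whose first `true` is at a position `n` such that `P n k m` holds, where `m` is the
number of entries after that position. -/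
def stringCode (P : ℕ → ℕ → ℕ → Bool) (k : ℕ) : Set (List Bool) :=
  {σ | σ.idxOf true < σ.length ∧
    P (σ.idxOf true) k (σ.length - (σ.idxOf true + 1)) = true}

theorem mem_Cyl_stringCode {P : ℕ → ℕ → ℕ → Bool} {k : ℕ} {X : ℕ → Bool} :
    X ∈ Cyl (stringCode P k) ↔ ∃ n, X ∈ firstOne n ∧ ∃ m, P n k m = true := by
  constructor
  · rintro ⟨σ, ⟨hlt, hP⟩, hX⟩
    refine ⟨σ.idxOf true, ⟨fun j hj => ?_, ?_⟩, _, hP⟩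
    · have h := hX ⟨j, hj.trans hlt⟩
      simp only [List.get_eq_getElem] at h
      rw [h]
      have := List.not_of_lt_findIdx hj
      simpa using this
    · have h := hX ⟨_, hlt⟩
      simp only [List.get_eq_getElem] at h
      rw [h]
      exact List.getElem_idxOf hlt
  · rintro ⟨n, hn, m, hP⟩
    have hidx : (List.ofFn fun i : Fin (n + 1 + m) => X i).idxOf true = n := by
      rw [List.idxOf, List.findIdx_eq (by simp; omega)]
      refine ⟨by simpa using hn.2, fun j hj => ?_⟩
      simpa using hn.1 j hj
    refine ⟨List.ofFn fun i : Fin (n + 1 + m) => X i, ⟨?_, ?_⟩, fun i => by simp⟩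
    · rw [hidx]; simp; omega
    · rw [hidx]; simpa using hP

theorem iInter_Cyl_stringCode (P : ℕ → ℕ → ℕ → Bool) :
    ⋂ k, Cyl (stringCode P k) = ⋃ n ∈ {n | ∀ k, ∃ m, P n k m = true}, firstOne n := by
  ext X
  simp only [Set.mem_iInter, mem_Cyl_stringCode, Set.mem_iUnion, Set.mem_ofPred_eq, exists_prop]
  constructor
  · intro h
    obtain ⟨n, hn, -⟩ := h 0
    refine ⟨n, fun k => ?_, hn⟩
    obtain ⟨n', hn', hm⟩ := h k
    rwa [firstOne_unique hn hn']
  · rintro ⟨n, hP, hn⟩ k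
    exact ⟨n, hn, hP k⟩

theorem computableCode_stringCode {P : ℕ → ℕ → ℕ → Bool}
    (hP : Primrec fun a : ℕ × ℕ × ℕ => P a.1 a.2.1 a.2.2) : ComputableCode (stringCode P) := by
  refine ⟨fun k σ => decide (σ.idxOf true < σ.length) &&
    P (σ.idxOf true) k (σ.length - (σ.idxOf true + 1)), ?_, by simp [stringCode]⟩
  have hidx : Primrec fun a : ℕ × List Bool => a.2.idxOf true :=
    Primrec.list_idxOf.comp (Primrec.const true) Primrec.snd
  have hlen : Primrec fun a : ℕ × List Bool => a.2.length := Primrec.list_length.comp Primrec.snd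
  refine Primrec.to_comp (Primrec.and.comp ?_ ?_)
  · exact (Primrec.nat_lt.comp hidx hlen).decide
  · exact hP.comp (hidx.pair (Primrec.fst.pair
      (Primrec.nat_sub.comp hlen (Primrec.succ.comp hidx))))

/-- For even `n`, whether the program with code `n / 2`, on input `(n, k, m.unpair.2)`, halts
with output `0` within `m.unpair.1` steps. -/
def diag (n k m : ℕ) : Bool :=
  decide (n % 2 = 0) && decide (Nat.Partrec.Code.evaln m.unpair.1
    (Denumerable.ofNat Nat.Partrec.Code (n / 2))
    (Nat.pair n (Nat.pair k m.unpair.2)) = some 0)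

theorem primrec_diag : Primrec fun a : ℕ × ℕ × ℕ => diag a.1 a.2.1 a.2.2 := by
  have hn : Primrec fun a : ℕ × ℕ × ℕ => a.1 := Primrec.fst
  have hk : Primrec fun a : ℕ × ℕ × ℕ => a.2.1 := Primrec.fst.comp Primrec.snd
  have hm : Primrec fun a : ℕ × ℕ × ℕ => a.2.2.unpair :=
    Primrec.unpair.comp (Primrec.snd.comp Primrec.snd)
  refine Primrec.and.comp ?_ ?_
  · exact (Primrec.eq.comp (Primrec.nat_mod.comp hn (Primrec.const 2)) (Primrec.const 0)).decide
  · refine (Primrec.eq.comp (Nat.Partrec.Code.primrec_evaln.comp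
      (((Primrec.fst.comp hm).pair ((Primrec.ofNat Nat.Partrec.Code).comp
        (Primrec.nat_div.comp hn (Primrec.const 2)))).pair ?_)) (Primrec.const (some 0))).decide
    exact Primrec₂.natPair.comp hn (Primrec₂.natPair.comp hk (Primrec.snd.comp hm))

theorem diag_eq_false_of_odd {n : ℕ} (hn : n % 2 = 1) (k m : ℕ) : diag n k m = false := by
  simp [diag, hn]

/-- Every computable ternary relation is negated by `diag` at some even section. -/
theorem exists_diag_iff {Q : ℕ × ℕ × ℕ → Bool} (hQ : Computable Q) :
    ∃ n, n % 2 = 0 ∧ ∀ k, (∃ m, diag n k m = true) ↔ ∃ m, Q (n, k, m) = false := by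
  obtain ⟨c, hc⟩ := Nat.Partrec.Code.exists_code.1 hQ
  have hev : ∀ n k m, c.eval (Nat.pair n (Nat.pair k m)) =
      Part.some (Encodable.encode (Q (n, k, m))) := by
    intro n k m
    rw [hc]
    simp
  refine ⟨2 * Encodable.encode c, by omega, fun k => ?_⟩
  have hdiag : ∀ m, diag (2 * Encodable.encode c) k m = true ↔ Nat.Partrec.Code.evaln m.unpair.1 c
      (Nat.pair (2 * Encodable.encode c) (Nat.pair k m.unpair.2)) = some 0 := by
    intro m
    simp [diag]
  simp only [hdiag]
  constructor
  · rintro ⟨m, hm⟩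
    refine ⟨m.unpair.2, ?_⟩
    have h := Nat.Partrec.Code.evaln_sound (Option.mem_def.2 hm)
    rw [hev, Part.mem_some_iff] at h
    cases hb : Q (2 * Encodable.encode c, k, m.unpair.2)
    · rfl
    · simp [hb] at h
  · rintro ⟨m, hm⟩
    have h : 0 ∈ c.eval (Nat.pair (2 * Encodable.encode c) (Nat.pair k m)) := by
      rw [hev, hm]
      simp
    obtain ⟨s, hs⟩ := Nat.Partrec.Code.evaln_complete.1 h
    exact ⟨Nat.pair s m, by simpa using hs⟩

/-- The number whose binary digits record which of the first `j` entries of `L` are `0`. -/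
def prefixNum (L : List ℕ) (j : ℕ) : ℕ :=
  Nat.rec 0 (fun i a => 2 * a + if L.getD i 0 = 0 then 1 else 0) j

theorem prefixNum_succ (L : List ℕ) (j : ℕ) :
    prefixNum L (j + 1) = 2 * prefixNum L j + if L.getD j 0 = 0 then 1 else 0 := rfl

theorem primrec_prefixNum : Primrec fun a : List ℕ × ℕ => prefixNum a.1 a.2 := by
  refine Primrec.nat_rec' Primrec.snd (Primrec.const 0)
    (h := fun (a : List ℕ × ℕ) (b : ℕ × ℕ) => 2 * b.2 + if a.1.getD b.1 0 = 0 then 1 else 0) ?_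
  have hget : Primrec fun p : (List ℕ × ℕ) × ℕ × ℕ => p.1.1.getD p.2.1 0 :=
    (Primrec.list_getD 0).comp (Primrec.fst.comp Primrec.fst) (Primrec.fst.comp Primrec.snd)
  exact Primrec.nat_add.comp
    (Primrec.nat_mul.comp (Primrec.const 2) (Primrec.snd.comp Primrec.snd))
    (Primrec.ite (Primrec.eq.comp hget (Primrec.const 0)) (Primrec.const 1) (Primrec.const 0))

theorem sum_eq_prefixNum_div (L : List ℕ) (j : ℕ) :
    (∑ i ∈ Finset.range j, if L.getD i 0 = 0 then (1 / 2 : ℝ) ^ (i + 1) else 0) =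
      prefixNum L j / 2 ^ j := by
  induction j with
  | zero => simp [prefixNum]
  | succ j ih =>
    rw [Finset.sum_range_succ, ih, prefixNum_succ]
    split_ifs
    · rw [one_div_pow]
      push_cast
      field_simp
      ring
    · push_cast
      field_simp
      ring

/-- The dyadic rational with binary expansion given by `L` up to `j`, followed by a `1`. -/
def prefixRat (L : List ℕ) (j : ℕ) : ℚ where
  num := ((2 * prefixNum L j + 1 : ℕ) : ℤ)
  den := 2 ^ (j + 1)
  den_nz := by positivity
  reduced := by
    refine Nat.Coprime.pow_right _ ?_
    simp

theorem cast_prefixRat (L : List ℕ) (j : ℕ) :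
    (prefixRat L j : ℝ) =
      (∑ i ∈ Finset.range j, if L.getD i 0 = 0 then (1 / 2 : ℝ) ^ (i + 1) else 0) +
        (1 / 2) ^ (j + 1) := by
  rw [sum_eq_prefixNum_div, Rat.cast_def]
  simp only [prefixRat]
  rw [one_div_pow]
  push_cast
  field_simp
  ring

theorem encode_prefixRat (L : List ℕ) (j : ℕ) :
    Encodable.encode (prefixRat L j) = Nat.pair (2 * (2 * prefixNum L j + 1)) (2 ^ (j + 1)) := rfl

theorem primrec_two_pow : Primrec fun n : ℕ => 2 ^ n := by
  refine (Primrec.nat_rec₁ 1 (f := fun _ a => 2 * a)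
    (Primrec.nat_mul.comp (Primrec.const 2) Primrec.snd)).of_eq fun n => ?_
  induction n with
  | zero => rfl
  | succ n ih => rw [pow_succ, ← ih, mul_comm]

theorem primrec_encode_prefixRat :
    Primrec fun a : List ℕ × ℕ => Encodable.encode (prefixRat a.1 a.2) := by
  simp only [encode_prefixRat]
  exact Primrec₂.natPair.comp
    (Primrec.nat_mul.comp (Primrec.const 2) (Primrec.succ.comp
      (Primrec.nat_mul.comp (Primrec.const 2) primrec_prefixNum)))
    (primrec_two_pow.comp (Primrec.succ.comp Primrec.snd))

/-- No search up to bound `m` refutes the witnesses stored in `L` below `j`: an entry `k + 1` at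
position `i` claims that `diag i k` is identically `false`. -/
def Unrefuted (L : List ℕ) (j m : ℕ) : Prop :=
  ∀ i < j, L.getD i 0 = 0 ∨ diag i (L.getD i 0 - 1) m = false

theorem primrecPred_unrefuted :
    PrimrecPred fun a : List ℕ × ℕ × ℕ => Unrefuted a.1 a.2.1 a.2.2 := by
  have hget : Primrec fun p : ℕ × List ℕ × ℕ => p.2.1.getD p.1 0 :=
    (Primrec.list_getD 0).comp (Primrec.fst.comp Primrec.snd) Primrec.fst
  have h : PrimrecRel fun (i : ℕ) (b : List ℕ × ℕ) =>
      b.1.getD i 0 = 0 ∨ diag i (b.1.getD i 0 - 1) b.2 = false := by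
    refine PrimrecPred.or (Primrec.eq.comp hget (Primrec.const 0))
      (Primrec.eq.comp ?_ (Primrec.const false))
    exact primrec_diag.comp (Primrec.fst.pair
      ((Primrec.pred.comp hget).pair (Primrec.snd.comp Primrec.snd)))
  refine (h.forall_mem_list.comp (Primrec.list_range.comp (Primrec.fst.comp Primrec.snd))
    (Primrec.fst.pair (Primrec.snd.comp Primrec.snd))).of_eq fun a => ?_
  simp [Unrefuted]

/-- There is a computable `G_δ` set `G` such that `{q : ℚ | μ(G) ≥ q}` is not `Σ⁰₂`. -/
theorem exists_Gdelta_measure_not_sigma02 :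
    ∃ W : ℕ → Set (List Bool), ComputableCode W ∧
      ¬ ∃ R : ℕ × ℕ × ℕ → Bool, Computable R ∧
        ∀ q : ℚ, (ENNReal.ofReal (q : ℝ) ≤ mu (⋂ k, Cyl (W k)) ↔
          ∃ k : ℕ, ∀ m : ℕ, R (Encodable.encode q, k, m) = true) := by
  classical
  refine ⟨stringCode diag, computableCode_stringCode primrec_diag, ?_⟩
  rintro ⟨R, hR, hRq⟩
  rw [iInter_Cyl_stringCode] at hRq
  set B : Set ℕ := {n | ∀ k, ∃ m, diag n k m = true} with hB
  have hRq' : ∀ L j, (prefixRat L j : ℝ) ≤ mu.real (⋃ i ∈ B, firstOne i) ↔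
      ∃ k, ∀ m, R (Encodable.encode (prefixRat L j), k, m) = true := by
    intro L j
    rw [← hRq, ENNReal.ofReal_le_iff_le_toReal (measure_ne_top _ _), Measure.real]
  let dec : ℕ → List ℕ × ℕ := Denumerable.ofNat (List ℕ × ℕ)
  let Q : ℕ × ℕ × ℕ → Bool := fun a =>
    R (Encodable.encode (prefixRat (dec a.2.1).1 a.1), (dec a.2.1).2, a.2.2) &&
      decide (Unrefuted (dec a.2.1).1 a.1 a.2.2)
  have hQ : Computable Q := by
    have hdec : Primrec fun a : ℕ × ℕ × ℕ => dec a.2.1 :=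
      (Primrec.ofNat _).comp (Primrec.fst.comp Primrec.snd)
    have hL := Primrec.fst.comp hdec
    have hm : Primrec fun a : ℕ × ℕ × ℕ => a.2.2 := Primrec.snd.comp Primrec.snd
    refine Primrec.and.to_comp.comp (hR.comp (Primrec.to_comp ?_)) (Primrec.to_comp ?_)
    · exact (primrec_encode_prefixRat.comp (hL.pair Primrec.fst)).pair
        ((Primrec.snd.comp hdec).pair hm)
    · exact (primrecPred_unrefuted.comp (hL.pair (Primrec.fst.pair hm))).decide
  obtain ⟨j, hj, hdiag⟩ := exists_diag_iff hQ
  have hodd : j + 1 ∉ B := fun h => by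
    obtain ⟨m, hm⟩ := h 0
    simp [diag_eq_false_of_odd (show (j + 1) % 2 = 1 by omega)] at hm
  have hmem : j ∈ B ↔ ∀ K, ∃ m, Q (j, K, m) = false := forall_congr' hdiag
  by_cases hjB : j ∈ B
  · have hwit : ∀ i, ∃ l, (l = 0 → i ∈ B) ∧ (l = 0 ∨ ∀ m, diag i (l - 1) m = false) := by
      intro i
      by_cases hi : i ∈ B
      · exact ⟨0, fun _ => hi, Or.inl rfl⟩
      · simp only [hB, Set.mem_ofPred_eq, not_forall, not_exists, Bool.not_eq_true] at hi
        obtain ⟨k, hk⟩ := hi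
        exact ⟨k + 1, by simp, Or.inr hk⟩
    choose w hw0 hw1 using hwit
    have hget : ∀ i < j, ((List.range j).map w).getD i 0 = w i := by
      intro i hi
      simp [List.getD_eq_getElem?_getD, hi]
    have hle : (prefixRat ((List.range j).map w) j : ℝ) ≤ mu.real (⋃ i ∈ B, firstOne i) := by
      rw [cast_prefixRat]
      exact sum_le_mu_real_iUnion (fun i hi h => hw0 i (by rwa [hget i hi] at h)) hjB
    obtain ⟨k, hk⟩ := (hRq' _ _).1 hle
    obtain ⟨m, hm⟩ := hmem.1 hjB (Encodable.encode ((List.range j).map w, k))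
    have hun : Unrefuted ((List.range j).map w) j m := by
      intro i hi
      rw [hget i hi]
      exact (hw1 i).imp_right fun h => h m
    simp [Q, dec, hk m, hun] at hm
  · obtain ⟨K, hK⟩ := not_forall.1 (mt hmem.2 hjB)
    simp only [not_exists, Bool.not_eq_false] at hK
    simp only [Q, Bool.and_eq_true, decide_eq_true_eq] at hK
    have hle := (hRq' _ _).2 ⟨_, fun m => (hK m).1⟩
    rw [cast_prefixRat] at hle
    refine absurd hle (not_le.2 (mu_real_iUnion_lt (fun i hi hiB => ?_) hjB hodd))
    by_contra h0
    obtain ⟨m, hm⟩ := hiB ((dec K).1.getD i 0 - 1)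
    rcases (hK m).2 i hi with h | h
    · exact h0 h
    · exact Bool.false_ne_true (h.symm.trans hm)

end LMD
end
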